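/- arXiv:2310.02649 — 10 statements merged into one kernel-verified Lean document; each statement's English description precedes it below -/
import Mathlib

section
/- Let γ : [−ℓ/2, ℓ/2] → ℝ³ be a smooth unit-speed curve lying on the unit sphere S² = {x ∈ ℝ³ : |x| = 1}, and set K̄ := max |γ''| (the maximum space curvature). If K̄ ℓ ≤ 2π, then the Euclidean chord length satisfies |γ(ℓ/2) − γ(−ℓ/2)| ≥ (2/K̄) sin(K̄ ℓ / 2), with equality only if |γ''| is constant along γ. -/
open Real

section SphericalCurve

variable {E : Type*} [NormedAddCommGroup E] [InnerProductSpace ℝ E]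

theorem inner_sq_le_of_inner_eq_zero {u v w : E} (hu : ‖u‖ = 1) (hv : ‖v‖ = 1)
    (huw : inner ℝ u w = 0) :
    inner ℝ w v ^ 2 ≤ ‖w‖ ^ 2 * (1 - inner ℝ u v ^ 2) := by
  have h1 : inner ℝ w (v - inner ℝ u v • u) = inner ℝ w v := by
    rw [inner_sub_right, inner_smul_right, real_inner_comm u w, huw, mul_zero, sub_zero]
  have h2 : ‖v - inner ℝ u v • u‖ ^ 2 = 1 - inner ℝ u v ^ 2 := by
    rw [norm_sub_sq_real, inner_smul_right, norm_smul, hu, hv, real_inner_comm u v,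
      Real.norm_eq_abs, mul_pow, sq_abs]
    ring
  rw [← h1, ← h2, ← mul_pow]
  exact sq_le_sq' (neg_le_of_abs_le (abs_real_inner_le_norm _ _)) (real_inner_le_norm _ _)

variable {T T' : ℝ → E} {a b K : ℝ}

theorem inner_deriv_eq_zero_of_norm_eq_one (hT : ∀ s, HasDerivAt T (T' s) s) (hab : a < b)
    (hunit : ∀ s ∈ Set.Icc a b, ‖T s‖ = 1) {s : ℝ} (hs : s ∈ Set.Icc a b) :
    inner ℝ (T s) (T' s) = 0 := by
  have h1 : HasDerivWithinAt (fun t => ‖T t‖ ^ 2) (2 * inner ℝ (T s) (T' s)) (Set.Icc a b) s :=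
    (hT s).norm_sq.hasDerivWithinAt
  have h2 : HasDerivWithinAt (fun t => ‖T t‖ ^ 2) 0 (Set.Icc a b) s :=
    (hasDerivWithinAt_const s (Set.Icc a b) (1 : ℝ)).congr
      (fun t ht => by simp [hunit t ht]) (by simp [hunit s hs])
  have := (uniqueDiffOn_Icc hab s hs).eq_deriv _ h1 h2
  linarith

theorem arccos_inner_le_of_norm_deriv_le (hT : ∀ s, HasDerivAt T (T' s) s) (hab : a < b)
    (hunit : ∀ s ∈ Set.Icc a b, ‖T s‖ = 1) (hK : ∀ s ∈ Set.Icc a b, ‖T' s‖ ≤ K)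
    {s t : ℝ} (hs : s ∈ Set.Icc a b) (ht : t ∈ Set.Icc a b) :
    arccos (inner ℝ (T s) (T t)) ≤ K * |s - t| := by
  have hscaled : ∀ c ∈ Set.Ioo (0 : ℝ) 1,
      arccos (c * inner ℝ (T s) (T t)) ≤ arccos c + K * |s - t| := by
    intro c hc
    have hlt : ∀ r ∈ Set.Icc a b, (c * inner ℝ (T r) (T t)) ^ 2 < 1 := by
      intro r hr
      have h := abs_real_inner_le_norm (T r) (T t)
      rw [hunit r hr, hunit t ht, one_mul] at h
      have h' := (sq_le_one_iff_abs_le_one _).2 h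
      rw [mul_pow]
      nlinarith [hc.1, hc.2, sq_nonneg (inner ℝ (T r) (T t))]
    have hder : ∀ r ∈ Set.Icc a b,
        HasDerivWithinAt (fun r => arccos (c * inner ℝ (T r) (T t)))
          (-(1 / √(1 - (c * inner ℝ (T r) (T t)) ^ 2)) * (c * inner ℝ (T' r) (T t)))
          (Set.Icc a b) r := by
      intro r hr
      have hi : HasDerivAt (fun r => c * inner ℝ (T r) (T t)) (c * inner ℝ (T' r) (T t)) r := by
        simpa using ((hT r).inner ℝ (hasDerivAt_const r (T t))).const_mul c
      have hl := hlt r hr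
      refine ((hasDerivAt_arccos ?_ ?_).comp r hi).hasDerivWithinAt
      · intro h; rw [h] at hl; norm_num at hl
      · intro h; rw [h] at hl; norm_num at hl
    have hbound : ∀ r ∈ Set.Icc a b,
        ‖-(1 / √(1 - (c * inner ℝ (T r) (T t)) ^ 2)) * (c * inner ℝ (T' r) (T t))‖ ≤ K := by
      intro r hr
      have hpos : 0 < 1 - (c * inner ℝ (T r) (T t)) ^ 2 := by linarith [hlt r hr]
      have hsq := inner_sq_le_of_inner_eq_zero (hunit r hr) (hunit t ht)
        (inner_deriv_eq_zero_of_norm_eq_one hT hab hunit hr)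
      have hK0 : 0 ≤ K := (norm_nonneg _).trans (hK r hr)
      have hK2 : ‖T' r‖ ^ 2 ≤ K ^ 2 := pow_le_pow_left₀ (norm_nonneg _) (hK r hr) 2
      rw [norm_mul, norm_neg, Real.norm_eq_abs, Real.norm_eq_abs,
        abs_of_pos (one_div_pos.2 (sqrt_pos.2 hpos)), one_div, inv_mul_le_iff₀ (sqrt_pos.2 hpos)]
      apply abs_le_of_sq_le_sq _ (by positivity)
      rw [mul_pow, mul_pow, sq_sqrt hpos.le]
      have hc2 : c ^ 2 ≤ 1 := by nlinarith [hc.1, hc.2]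
      have hf : inner ℝ (T r) (T t) ^ 2 ≤ 1 := by
        rw [sq_le_one_iff_abs_le_one]
        simpa [hunit r hr, hunit t ht] using abs_real_inner_le_norm (T r) (T t)
      calc c ^ 2 * inner ℝ (T' r) (T t) ^ 2
          ≤ c ^ 2 * (K ^ 2 * (1 - inner ℝ (T r) (T t) ^ 2)) := by
            gcongr
            exact hsq.trans (by gcongr)
        _ ≤ (1 - (c * inner ℝ (T r) (T t)) ^ 2) * K ^ 2 := by
            nlinarith [mul_nonneg (sq_nonneg K) (sub_nonneg.2 hc2)]
    have hmv := (convex_Icc a b).norm_image_sub_le_of_norm_hasDerivWithin_le hder hbound ht hs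
    rw [real_inner_self_eq_norm_sq, hunit t ht, Real.norm_eq_abs, Real.norm_eq_abs] at hmv
    norm_num at hmv
    linarith [le_abs_self (arccos (c * inner ℝ (T s) (T t)) - arccos c)]
  have hcl : (1 : ℝ) ∈ closure (Set.Ioo (0 : ℝ) 1) := by
    rw [closure_Ioo zero_ne_one]; simp
  have hle := le_on_closure hscaled
    (continuous_arccos.comp (continuous_id.mul continuous_const)).continuousOn
    (continuous_arccos.add continuous_const).continuousOn hcl
  simpa using hle

theorem cos_le_inner_of_norm_deriv_le (hT : ∀ s, HasDerivAt T (T' s) s) (hab : a < b)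
    (hunit : ∀ s ∈ Set.Icc a b, ‖T s‖ = 1) (hK : ∀ s ∈ Set.Icc a b, ‖T' s‖ ≤ K)
    {s t : ℝ} (hs : s ∈ Set.Icc a b) (ht : t ∈ Set.Icc a b) (hπ : K * |s - t| ≤ π) :
    cos (K * (s - t)) ≤ inner ℝ (T s) (T t) := by
  have hK0 : 0 ≤ K := (norm_nonneg _).trans (hK s hs)
  have hf := abs_le.1 (show |inner ℝ (T s) (T t)| ≤ 1 by
    simpa [hunit s hs, hunit t ht] using abs_real_inner_le_norm (T s) (T t))
  have h := cos_le_cos_of_nonneg_of_le_pi (arccos_nonneg _) hπ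
    (arccos_inner_le_of_norm_deriv_le hT hab hunit hK hs ht)
  rwa [cos_arccos hf.1 hf.2, ← abs_of_nonneg hK0, ← abs_mul, cos_abs] at h

theorem le_norm_deriv_of_inner_eq_cos (hT : ∀ s, HasDerivAt T (T' s) s) (hab : a < b)
    (hunit : ∀ s ∈ Set.Icc a b, ‖T s‖ = 1) {t : ℝ} (ht : t ∈ Set.Icc a b)
    (hcos : ∀ s ∈ Set.Icc a b, inner ℝ (T s) (T t) = cos (K * (s - t)))
    {s : ℝ} (hs : s ∈ Set.Icc a b) (hsin : sin (K * (s - t)) ≠ 0) :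
    K ≤ ‖T' s‖ := by
  have h1 : HasDerivWithinAt (fun r => inner ℝ (T r) (T t)) (inner ℝ (T' s) (T t))
      (Set.Icc a b) s := by
    simpa using ((hT s).inner ℝ (hasDerivAt_const s (T t))).hasDerivWithinAt
  have h2 : HasDerivWithinAt (fun r => cos (K * (r - t))) (-sin (K * (s - t)) * (K * 1))
      (Set.Icc a b) s :=
    (((hasDerivAt_id s).sub_const t).const_mul K).cos.hasDerivWithinAt
  have heq := (uniqueDiffOn_Icc hab s hs).eq_deriv _ h1 (h2.congr hcos (hcos s hs))
  have hsq := inner_sq_le_of_inner_eq_zero (hunit s hs) (hunit t ht)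
    (inner_deriv_eq_zero_of_norm_eq_one hT hab hunit hs)
  rw [heq, hcos s hs, ← sin_sq] at hsq
  have hle : K ^ 2 ≤ ‖T' s‖ ^ 2 := by
    refine le_of_mul_le_mul_right ?_ (pow_pos (abs_pos.2 hsin) 2)
    rw [sq_abs]
    linarith
  exact le_of_sq_le_sq hle (norm_nonneg _)

end SphericalCurve

/-- For a smooth unit-speed curve `γ : [−ℓ/2, ℓ/2] → ℝ³` on the unit sphere, with maximum
space curvature `K̄ = max |γ''|`, if `K̄ ℓ ≤ 2π` then
`|γ(ℓ/2) − γ(−ℓ/2)| ≥ (2/K̄) sin(K̄ℓ/2)`, with equality only if `|γ''|` is constant. -/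
theorem chord_lower_bound (ℓ : ℝ) (hℓ : 0 < ℓ)
    (γ : ℝ → EuclideanSpace ℝ (Fin 3))
    (hsmooth : ContDiff ℝ (⊤ : ℕ∞) γ)
    (hsphere : ∀ s ∈ Set.Icc (-(ℓ / 2)) (ℓ / 2), ‖γ s‖ = 1)
    (hunit : ∀ s ∈ Set.Icc (-(ℓ / 2)) (ℓ / 2), ‖deriv γ s‖ = 1)
    (K : ℝ)
    (hK : IsGreatest ((fun s => ‖iteratedDeriv 2 γ s‖) '' Set.Icc (-(ℓ / 2)) (ℓ / 2)) K)
    (hKℓ : K * ℓ ≤ 2 * π) :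
    2 / K * Real.sin (K * ℓ / 2) ≤ ‖γ (ℓ / 2) - γ (-(ℓ / 2))‖ ∧
      (‖γ (ℓ / 2) - γ (-(ℓ / 2))‖ = 2 / K * Real.sin (K * ℓ / 2) →
        ∀ s₁ ∈ Set.Icc (-(ℓ / 2)) (ℓ / 2), ∀ s₂ ∈ Set.Icc (-(ℓ / 2)) (ℓ / 2),
          ‖iteratedDeriv 2 γ s₁‖ = ‖iteratedDeriv 2 γ s₂‖) := by
  have hderiv : ∀ s, HasDerivAt γ (deriv γ s) s := fun s =>
    ((hsmooth.differentiable (by simp)) s).hasDerivAt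
  have hsmooth' : ContDiff ℝ (⊤ : ℕ∞) (deriv γ) := (contDiff_infty_iff_deriv.1 hsmooth).2
  have hiter : iteratedDeriv 2 γ = deriv (deriv γ) := by
    rw [iteratedDeriv_succ, iteratedDeriv_one]
  have hderiv2 : ∀ s, HasDerivAt (deriv γ) (iteratedDeriv 2 γ s) s := fun s => by
    rw [hiter]
    exact ((hsmooth'.differentiable (by simp)) s).hasDerivAt
  have hcont2 : Continuous fun s => ‖iteratedDeriv 2 γ s‖ := by
    rw [hiter]
    exact (hsmooth'.continuous_deriv (by simp)).norm
  have hbd : ∀ s ∈ Set.Icc (-(ℓ / 2)) (ℓ / 2), ‖iteratedDeriv 2 γ s‖ ≤ K := fun s hs =>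
    hK.2 ⟨s, hs, rfl⟩
  have hab : -(ℓ / 2) < ℓ / 2 := by linarith
  have hmid : (0 : ℝ) ∈ Set.Icc (-(ℓ / 2)) (ℓ / 2) := ⟨by linarith, by linarith⟩
  rcases ((norm_nonneg _).trans (hbd 0 hmid)).eq_or_lt with hK0 | hK0
  · subst hK0
    refine ⟨by simp, fun _ s₁ h₁ s₂ h₂ => ?_⟩
    rw [le_antisymm (hbd s₁ h₁) (norm_nonneg _), le_antisymm (hbd s₂ h₂) (norm_nonneg _)]
  have hcos : ∀ s ∈ Set.Icc (-(ℓ / 2)) (ℓ / 2),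
      cos (K * (s - 0)) ≤ inner ℝ (deriv γ s) (deriv γ 0) := by
    intro s hs
    refine cos_le_inner_of_norm_deriv_le hderiv2 hab hunit hbd hs hmid ?_
    have : |s - 0| ≤ ℓ / 2 := by simpa using abs_le.2 hs
    nlinarith
  set h : ℝ → ℝ := fun s => inner ℝ (γ s) (deriv γ 0) - sin (K * (s - 0)) / K with hdef
  have hh : ∀ s, HasDerivAt h (inner ℝ (deriv γ s) (deriv γ 0) - cos (K * (s - 0))) s := by
    intro s
    have h1 : HasDerivAt (fun r => inner ℝ (γ r) (deriv γ 0))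
        (inner ℝ (deriv γ s) (deriv γ 0)) s := by
      simpa using (hderiv s).inner ℝ (hasDerivAt_const s (deriv γ 0))
    have h2 := ((((hasDerivAt_id s).sub_const 0).const_mul K).sin).div_const K
    refine (h1.sub h2).congr_deriv ?_
    simp [hK0.ne']
  have hmono : MonotoneOn h (Set.Icc (-(ℓ / 2)) (ℓ / 2)) := by
    refine monotoneOn_of_hasDerivWithinAt_nonneg (convex_Icc _ _)
      (fun s _ => (hh s).continuousAt.continuousWithinAt)
      (fun s _ => (hh s).hasDerivWithinAt) fun s hs => ?_
    exact sub_nonneg.2 (hcos s (interior_subset hs))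
  have hleft := Set.left_mem_Icc.2 hab.le
  have hright := Set.right_mem_Icc.2 hab.le
  have hends : h (ℓ / 2) - h (-(ℓ / 2)) =
      inner ℝ (γ (ℓ / 2) - γ (-(ℓ / 2))) (deriv γ 0) - 2 / K * sin (K * ℓ / 2) := by
    simp only [hdef, inner_sub_left, sub_zero, mul_neg, sin_neg, mul_div_assoc]
    ring
  have hchord : inner ℝ (γ (ℓ / 2) - γ (-(ℓ / 2))) (deriv γ 0) ≤ ‖γ (ℓ / 2) - γ (-(ℓ / 2))‖ := by
    simpa [hunit 0 hmid] using real_inner_le_norm (γ (ℓ / 2) - γ (-(ℓ / 2))) (deriv γ 0)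
  have hle := hmono hleft hright hab.le
  refine ⟨by linarith, fun heq => ?_⟩
  have hconst : ∀ s ∈ Set.Icc (-(ℓ / 2)) (ℓ / 2), h s = h (ℓ / 2) := fun s hs =>
    le_antisymm (hmono hs hright hs.2) (by linarith [hmono hleft hs hs.1])
  have hinner : ∀ s ∈ Set.Icc (-(ℓ / 2)) (ℓ / 2),
      inner ℝ (deriv γ s) (deriv γ 0) = cos (K * (s - 0)) := fun s hs =>
    sub_eq_zero.1 <| (uniqueDiffOn_Icc hab s hs).eq_deriv _ (hh s).hasDerivWithinAt
      ((hasDerivWithinAt_const s _ (h (ℓ / 2))).congr hconst (hconst s hs))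
  have hpos : ∀ s ∈ Set.Ioo 0 (ℓ / 2), 0 < sin (K * s) := fun s hs =>
    sin_pos_of_pos_of_lt_pi (mul_pos hK0 hs.1) (by nlinarith [hs.2])
  have hgeR : ∀ s ∈ Set.Ioo 0 (ℓ / 2), K ≤ ‖iteratedDeriv 2 γ s‖ := fun s hs =>
    le_norm_deriv_of_inner_eq_cos hderiv2 hab hunit hmid hinner
      ⟨by linarith [hs.1], hs.2.le⟩ (by simpa using (hpos s hs).ne')
  have hgeL : ∀ s ∈ Set.Ioo (-(ℓ / 2)) 0, K ≤ ‖iteratedDeriv 2 γ s‖ := fun s hs =>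
    le_norm_deriv_of_inner_eq_cos hderiv2 hab hunit hmid hinner
      ⟨hs.1.le, by linarith [hs.2]⟩
      (by simpa using (hpos (-s) ⟨by linarith [hs.2], by linarith [hs.1]⟩).ne')
  have hall : ∀ s ∈ Set.Icc (-(ℓ / 2)) (ℓ / 2), ‖iteratedDeriv 2 γ s‖ = K := by
    intro s hs
    refine le_antisymm (hbd s hs) ?_
    rcases le_total 0 s with h0 | h0
    · refine le_on_closure hgeR continuousOn_const hcont2.continuousOn ?_
      rw [closure_Ioo (by linarith)]
      exact ⟨h0, hs.2⟩
    · refine le_on_closure hgeL continuousOn_const hcont2.continuousOn ?_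
      rw [closure_Ioo (by linarith)]
      exact ⟨hs.1, h0⟩
  intro s₁ h₁ s₂ h₂
  rw [hall s₁ h₁, hall s₂ h₂]
end

section
/- For every a > 0, the function φ(z) := a⁻¹ arctan((a/π) sin(π z)) on [0,1] satisfies: (i) φ(1 − z) = φ(z) for all z ∈ [0,1]; (ii) |φ'(z)| ≤ 1 for all z ∈ [0,1]; and (iii) φ is strictly concave on [0,1]. -/
open Real

/-- The Andrews–Bryan comparison (barrier) function `φ(z) = a⁻¹ arctan((a/π) sin(πz))`. -/
noncomputable def phi (a : ℝ) : ℝ → ℝ :=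
  fun z => a⁻¹ * Real.arctan (a / π * Real.sin (π * z))

theorem hasDerivAt_phi {a : ℝ} (ha : a ≠ 0) (z : ℝ) :
    HasDerivAt (phi a) (cos (π * z) / (1 + (a / π * sin (π * z)) ^ 2)) z := by
  have h := (((((hasDerivAt_id z).const_mul π).sin).const_mul (a / π)).arctan).const_mul a⁻¹
  refine h.congr_deriv ?_
  have hden : 1 + (a / π * sin (π * z)) ^ 2 ≠ 0 := by positivity
  simp only [id, mul_one]
  field_simp

theorem deriv_phi {a : ℝ} (ha : a ≠ 0) :
    deriv (phi a) = fun z => cos (π * z) / (1 + (a / π * sin (π * z)) ^ 2) :=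
  funext fun z => (hasDerivAt_phi ha z).deriv

theorem phi_one_sub (a z : ℝ) : phi a (1 - z) = phi a z := by
  simp only [phi, mul_sub, mul_one, sin_pi_sub]

theorem abs_deriv_phi_le_one {a : ℝ} (ha : a ≠ 0) (z : ℝ) : |deriv (phi a) z| ≤ 1 := by
  have hden : 1 ≤ 1 + (a / π * sin (π * z)) ^ 2 := le_add_of_nonneg_right (sq_nonneg _)
  rw [deriv_phi ha, abs_div, abs_of_pos (zero_lt_one.trans_le hden)]
  exact div_le_one_of_le₀ ((abs_cos_le_one _).trans hden) (zero_le_one.trans hden)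

theorem strictAntiOn_deriv_phi {a : ℝ} (ha : a ≠ 0) :
    StrictAntiOn (deriv (phi a)) (Set.Icc 0 1) := by
  intro x hx y hy hxy
  have hmem : ∀ {z : ℝ}, z ∈ Set.Icc (0 : ℝ) 1 → π * z ∈ Set.Icc 0 π := fun hz =>
    ⟨mul_nonneg pi_pos.le hz.1, mul_le_of_le_one_right pi_pos.le hz.2⟩
  have hcos : cos (π * y) < cos (π * x) :=
    strictAntiOn_cos (hmem hx) (hmem hy) (mul_lt_mul_of_pos_left hxy pi_pos)
  have hprod : 0 ≤ 1 + cos (π * x) * cos (π * y) := by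
    have h : |cos (π * x) * cos (π * y)| ≤ 1 := by
      rw [abs_mul]
      exact mul_le_one₀ (abs_cos_le_one _) (abs_nonneg _) (abs_cos_le_one _)
    linarith [(abs_le.mp h).1]
  rw [deriv_phi ha]
  dsimp only
  rw [div_lt_div_iff₀ (by positivity) (by positivity), mul_pow, mul_pow, sin_sq, sin_sq]
  have hpos : 0 < (cos (π * x) - cos (π * y)) *
      (1 + (a / π) ^ 2 * (1 + cos (π * x) * cos (π * y))) :=
    mul_pos (sub_pos.mpr hcos) (by positivity)
  linarith

theorem strictConcaveOn_phi {a : ℝ} (ha : a ≠ 0) :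
    StrictConcaveOn ℝ (Set.Icc 0 1) (phi a) :=
  StrictAntiOn.strictConcaveOn_of_deriv (convex_Icc 0 1)
    (fun z _ => (hasDerivAt_phi ha z).continuousAt.continuousWithinAt)
    ((strictAntiOn_deriv_phi ha).mono interior_subset)

/-- For every `a > 0`, the barrier `φ(z) = a⁻¹ arctan((a/π) sin(πz))` on `[0,1]` satisfies:
(i) `φ(1 − z) = φ(z)`; (ii) `|φ'| ≤ 1`; (iii) `φ` is strictly concave. -/
theorem phi_properties (a : ℝ) (ha : 0 < a) :
    (∀ z ∈ Set.Icc (0 : ℝ) 1, phi a (1 - z) = phi a z) ∧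
    (∀ z ∈ Set.Icc (0 : ℝ) 1, |deriv (phi a) z| ≤ 1) ∧
    StrictConcaveOn ℝ (Set.Icc 0 1) (phi a) :=
  ⟨fun z _ => phi_one_sub a z, fun z _ => abs_deriv_phi_le_one ha.ne' z,
    strictConcaveOn_phi ha.ne'⟩
end

section
/- Fix a > 0 and let φ(z) := a⁻¹ arctan((a/π) sin(π z)) on [0,1]. For every L > 0 such that L φ(z) ≤ 2 for all z ∈ [0,1], the function z ↦ arccos(1 − L²φ(z)²/2) is strictly concave on (0,1). -/
open Real

/-- The function `t ↦ 1 / t - cot t` is increasing on `(0, π)`, with denominators cleared. -/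
theorem mul_sin_mul_sub_le_of_lt_pi {p q : ℝ} (hp : 0 < p) (hpq : p ≤ q) (hq : q < π) :
    q * sin q * (sin p - p * cos p) ≤ p * sin p * (sin q - q * cos q) := by
  have hsin : ∀ t ∈ Set.Ioo 0 π, 0 < sin t := fun t ht => sin_pos_of_mem_Ioo ht
  have hderiv : ∀ t ∈ Set.Ioo 0 π,
      HasDerivAt (fun t => t⁻¹ - cos t / sin t) (1 / sin t ^ 2 - 1 / t ^ 2) t := by
    intro t ht
    have hs := (hsin t ht).ne'
    have ht0 : t ≠ 0 := ht.1.ne'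
    refine ((hasDerivAt_inv ht0).sub
      ((hasDerivAt_cos t).div (hasDerivAt_sin t) hs)).congr_deriv ?_
    have := sin_sq_add_cos_sq t
    field_simp
    linear_combination t ^ 2 * this
  have hmono : MonotoneOn (fun t => t⁻¹ - cos t / sin t) (Set.Ioo 0 π) := by
    refine monotoneOn_of_deriv_nonneg (convex_Ioo 0 π)
      (fun t ht => (hderiv t ht).continuousAt.continuousWithinAt)
      (fun t ht => (hderiv t (interior_subset ht)).differentiableAt.differentiableWithinAt) ?_
    intro t ht
    have ht' := interior_subset ht
    rw [(hderiv t ht').deriv, sub_nonneg]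
    have h0 := hsin t ht'
    have h1 := sin_le ht'.1.le
    gcongr
  have hp' : p ∈ Set.Ioo 0 π := ⟨hp, hpq.trans_lt hq⟩
  have hq' : q ∈ Set.Ioo 0 π := ⟨hp.trans_le hpq, hq⟩
  have h := hmono hp' hq' hpq
  have hsp := hsin p hp'
  have hsq := hsin q hq'
  have hq0 := hq'.1
  have h2 := mul_le_mul_of_nonneg_left h (by positivity : 0 ≤ p * q * sin p * sin q)
  field_simp at h2
  nlinarith

theorem mul_tan_sq_sub_lt {A u : ℝ} (hu : 0 < u) (huA : u < A) (hA : A < π / 2) :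
    u * (tan A ^ 2 - tan u ^ 2) <
      tan u * (1 + 2 * tan A ^ 2 - tan u ^ 2) * (A ^ 2 - u ^ 2) := by
  have key := mul_sin_mul_sub_le_of_lt_pi (p := A - u) (q := A + u)
    (by linarith) (by linarith) (by linarith)
  have hcu : 0 < cos u := cos_pos_of_mem_Ioo ⟨by linarith, by linarith⟩
  have hcA : 0 < cos A := cos_pos_of_mem_Ioo ⟨by linarith, by linarith⟩
  have hsu : 0 < sin u := sin_pos_of_pos_of_lt_pi hu (by linarith)
  have hSp : 0 < sin (A - u) := sin_pos_of_pos_of_lt_pi (by linarith) (by linarith)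
  have hSq : 0 < sin (A + u) := sin_pos_of_pos_of_lt_pi (by linarith) (by linarith)
  have hpos : 0 < 2 * sin u * (sin (A - u) * sin (A + u)) * ((A - u) * (A + u)) := by
    have : 0 < A - u := by linarith
    have : 0 < A + u := by linarith
    positivity
  rw [sin_add, sin_sub, cos_add, cos_sub] at key
  rw [sin_add, sin_sub] at hpos
  rw [tan_eq_sin_div_cos, tan_eq_sin_div_cos]
  have hu1 : sin u ^ 2 = 1 - cos u ^ 2 := sin_sq u
  have hA1 : sin A ^ 2 = 1 - cos A ^ 2 := sin_sq A
  have hS : (sin A * cos u - cos A * sin u) * (sin A * cos u + cos A * sin u)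
      = cos u ^ 2 - cos A ^ 2 := by
    linear_combination cos u ^ 2 * hA1 - cos A ^ 2 * hu1
  have hdiff : (sin A * cos u + cos A * sin u) * (cos A * cos u + sin A * sin u)
      - (cos A * cos u - sin A * sin u) * (sin A * cos u - cos A * sin u)
      = 2 * sin u * cos u := by
    linear_combination (2 * sin u * cos u) * hA1
  have hmain : u * (cos u ^ 2 - cos A ^ 2) * cos u <
      sin u * (2 * cos u ^ 2 - cos A ^ 2) * (A ^ 2 - u ^ 2) := by
    have h1 : 2 * u * (cos u ^ 2 - cos A ^ 2) ≤ (A - u) * (A + u) * (2 * sin u * cos u) := by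
      rw [← hS, ← hdiff]
      linarith
    rw [hS] at hpos
    nlinarith [mul_le_mul_of_nonneg_left h1 hcu.le]
  have e1 : u * ((sin A / cos A) ^ 2 - (sin u / cos u) ^ 2) =
      u * (cos u ^ 2 - cos A ^ 2) * cos u / (cos A ^ 2 * cos u ^ 3) := by
    rw [div_pow, div_pow, hA1, hu1]
    field_simp
    ring
  have e2 : sin u / cos u * (1 + 2 * (sin A / cos A) ^ 2 - (sin u / cos u) ^ 2) * (A ^ 2 - u ^ 2)
      = sin u * (2 * cos u ^ 2 - cos A ^ 2) * (A ^ 2 - u ^ 2) / (cos A ^ 2 * cos u ^ 3) := by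
    rw [div_pow (sin A), div_pow (sin u), hA1, hu1]
    field_simp
    ring
  rw [e1, e2]
  gcongr

theorem hasDerivAt_arctan_mul_sin (k x : ℝ) :
    HasDerivAt (fun x => arctan (k * sin x)) (k * cos x / (1 + (k * sin x) ^ 2)) x := by
  convert ((hasDerivAt_sin x).const_mul k).arctan using 1
  ring

theorem arctan_mul_sin_bounds {k x : ℝ} (hk : 0 < k) (hx : x ∈ Set.Ioo 0 (π / 2)) :
    0 < arctan (k * sin x) ∧ arctan (k * sin x) < arctan k := by
  have hs : 0 < sin x := sin_pos_of_pos_of_lt_pi hx.1 (by linarith [hx.1, hx.2])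
  have hs1 : sin x < 1 := by
    rw [← sin_pi_div_two]
    exact sin_lt_sin_of_lt_of_le_pi_div_two (by linarith [hx.1, pi_pos]) le_rfl hx.2
  exact ⟨arctan_pos.2 (by positivity), arctan_strictMono (by nlinarith)⟩

theorem arctan_mul_sin_second_order {c k x : ℝ} (hc : 0 < c) (hk : 0 < k)
    (hck : c * arctan k ≤ 1) (hx : x ∈ Set.Ioo 0 (π / 2)) :
    c ^ 2 * arctan (k * sin x) * (k ^ 2 - (k * sin x) ^ 2) <
      k * sin x * (1 + 2 * k ^ 2 - (k * sin x) ^ 2) * (1 - (c * arctan (k * sin x)) ^ 2) := by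
  obtain ⟨hu, huA⟩ := arctan_mul_sin_bounds hk hx
  have h := mul_tan_sq_sub_lt hu huA (arctan_lt_pi_div_two k)
  rw [tan_arctan, tan_arctan] at h
  have hs : 0 < sin x := sin_pos_of_pos_of_lt_pi hx.1 (by linarith [hx.1, hx.2])
  have hw : 0 < k * sin x := by positivity
  have hwk : k * sin x ≤ k := by nlinarith [sin_le_one x]
  have hfac : 0 < k * sin x * (1 + 2 * k ^ 2 - (k * sin x) ^ 2) :=
    mul_pos hw (by nlinarith)
  have hA : (c * arctan k) ^ 2 ≤ 1 := by
    have : 0 < c * arctan k := mul_pos hc (hu.trans huA)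
    nlinarith
  calc c ^ 2 * arctan (k * sin x) * (k ^ 2 - (k * sin x) ^ 2)
      = c ^ 2 * (arctan (k * sin x) * (k ^ 2 - (k * sin x) ^ 2)) := by ring
    _ < c ^ 2 * (k * sin x * (1 + 2 * k ^ 2 - (k * sin x) ^ 2)
          * (arctan k ^ 2 - arctan (k * sin x) ^ 2)) := by gcongr
    _ = k * sin x * (1 + 2 * k ^ 2 - (k * sin x) ^ 2)
          * ((c * arctan k) ^ 2 - (c * arctan (k * sin x)) ^ 2) := by ring
    _ ≤ _ := by gcongr

theorem strictConcaveOn_arcsin_mul_arctan_mul_sin {c k : ℝ} (hc : 0 < c) (hk : 0 < k)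
    (hck : c * arctan k ≤ 1) :
    StrictConcaveOn ℝ (Set.Ioc 0 (π / 2)) (fun x => arcsin (c * arctan (k * sin x))) := by
  have hlt : ∀ x ∈ Set.Ioo 0 (π / 2),
      0 < c * arctan (k * sin x) ∧ c * arctan (k * sin x) < 1 := fun x hx =>
    have h := arctan_mul_sin_bounds hk hx
    ⟨mul_pos hc h.1, (mul_lt_mul_of_pos_left h.2 hc).trans_le hck⟩
  have hD : ∀ x ∈ Set.Ioo 0 (π / 2), 0 < 1 - (c * arctan (k * sin x)) ^ 2 := fun x hx => by
    nlinarith [hlt x hx]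
  have hderiv : ∀ x ∈ Set.Ioo 0 (π / 2),
      deriv (fun x => arcsin (c * arctan (k * sin x))) x =
        c * (k * cos x / (1 + (k * sin x) ^ 2)) / √(1 - (c * arctan (k * sin x)) ^ 2) := by
    intro x hx
    obtain ⟨h0, h1⟩ := hlt x hx
    have h := (hasDerivAt_arcsin (by linarith) h1.ne).comp x
      ((hasDerivAt_arctan_mul_sin k x).const_mul c)
    rw [Function.comp_def] at h
    rw [h.deriv]
    ring
  have hderiv2 : ∀ x ∈ Set.Ioo 0 (π / 2), ∃ d < 0, HasDerivAt
      (fun x => c * (k * cos x / (1 + (k * sin x) ^ 2)) / √(1 - (c * arctan (k * sin x)) ^ 2))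
        d x := by
    intro x hx
    have hDx := hD x hx
    have hden : 1 + (k * sin x) ^ 2 ≠ 0 := by positivity
    have hV : HasDerivAt (fun x => c * (k * cos x / (1 + (k * sin x) ^ 2))) _ x :=
      ((((hasDerivAt_cos x).const_mul k).div
        ((((hasDerivAt_sin x).const_mul k).pow 2).const_add 1) hden).const_mul c)
    have hR : HasDerivAt (fun x => √(1 - (c * arctan (k * sin x)) ^ 2)) _ x :=
      (((((hasDerivAt_arctan_mul_sin k x).const_mul c).pow 2).const_sub 1).sqrt hDx.ne')
    refine ⟨_, ?_, hV.div hR (sqrt_pos.2 hDx).ne'⟩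
    simp only [Pi.pow_apply]
    have hkey := arctan_mul_sin_second_order hc hk hck hx
    have hr := sqrt_pos.2 hDx
    have hr2 := sq_sqrt hDx.le
    set r := √(1 - (c * arctan (k * sin x)) ^ 2)
    set u := arctan (k * sin x)
    have hcos : cos x ^ 2 = 1 - sin x ^ 2 := cos_sq' x
    refine div_neg_of_neg_of_pos ?_ (by positivity)
    rw [← hr2] at hkey
    have : ∀ e : ℝ, e = c / (r * (1 + (k * sin x) ^ 2) ^ 2) *
        (c ^ 2 * u * (k ^ 2 - (k * sin x) ^ 2) -
          k * sin x * (1 + 2 * k ^ 2 - (k * sin x) ^ 2) * r ^ 2) → e < 0 := by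
      rintro e rfl
      exact mul_neg_of_pos_of_neg (by positivity) (by linarith)
    apply this
    simp only [Nat.cast_ofNat, Nat.add_one_sub_one, pow_one]
    field_simp
    ring_nf
    simp only [hcos]
    ring
  refine StrictAntiOn.strictConcaveOn_of_deriv (convex_Ioc _ _) ?_ ?_
  · exact (continuous_arcsin.comp (by fun_prop)).continuousOn
  · rw [interior_Ioc]
    refine StrictAntiOn.congr ?_ (fun x hx => (hderiv x hx).symm)
    refine strictAntiOn_of_deriv_neg (convex_Ioo _ _) ?_ ?_
    · intro x hx
      obtain ⟨d, -, hd⟩ := hderiv2 x hx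
      exact hd.continuousAt.continuousWithinAt
    · intro x hx
      obtain ⟨d, hd0, hd⟩ := hderiv2 x (interior_subset hx)
      rwa [hd.deriv]

theorem strictMonoOn_arcsin_mul_arctan_mul_sin {c k : ℝ} (hc : 0 < c) (hk : 0 < k)
    (hck : c * arctan k ≤ 1) :
    StrictMonoOn (fun x => arcsin (c * arctan (k * sin x))) (Set.Ioc 0 (π / 2)) := by
  have hmem : ∀ x ∈ Set.Ioc 0 (π / 2), c * arctan (k * sin x) ∈ Set.Icc (-1 : ℝ) 1 := by
    intro x hx
    have hs : 0 < sin x := sin_pos_of_pos_of_lt_pi hx.1 (by linarith [hx.1, hx.2])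
    have h0 : 0 < arctan (k * sin x) := arctan_pos.2 (by positivity)
    have h1 : arctan (k * sin x) ≤ arctan k :=
      arctan_strictMono.monotone (by nlinarith [sin_le_one x])
    constructor <;> nlinarith
  intro x hx y hy hxy
  refine strictMonoOn_arcsin (hmem x hx) (hmem y hy) ?_
  have : sin x < sin y :=
    sin_lt_sin_of_lt_of_le_pi_div_two (by linarith [hx.1, pi_pos]) hy.2 hxy
  gcongr

theorem StrictConcaveOn.comp_pi_mul_min {g : ℝ → ℝ}
    (hg : StrictConcaveOn ℝ (Set.Ioc 0 (π / 2)) g) (hmono : StrictMonoOn g (Set.Ioc 0 (π / 2))) :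
    StrictConcaveOn ℝ (Set.Ioo 0 1) (fun z => g (π * min z (1 - z))) := by
  have hmem : ∀ z ∈ Set.Ioo (0 : ℝ) 1, π * min z (1 - z) ∈ Set.Ioc 0 (π / 2) := by
    intro z hz
    refine ⟨mul_pos pi_pos (lt_min hz.1 (by linarith [hz.2])), ?_⟩
    have : min z (1 - z) ≤ 1 / 2 := by
      rcases le_total z (1 / 2) with h | h
      · exact (min_le_left _ _).trans h
      · exact (min_le_right _ _).trans (by linarith)
    nlinarith [pi_pos]
  refine ⟨convex_Ioo 0 1, ?_⟩
  intro x hx y hy hxy a b ha hb hab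
  have hz := convex_Ioo (0 : ℝ) 1 hx hy ha.le hb.le hab
  simp only [smul_eq_mul] at hz ⊢
  have hax : a * min x (1 - x) ≤ a * x := by gcongr; exact min_le_left _ _
  have hax' : a * min x (1 - x) ≤ a * (1 - x) := by gcongr; exact min_le_right _ _
  have hby : b * min y (1 - y) ≤ b * y := by gcongr; exact min_le_left _ _
  have hby' : b * min y (1 - y) ≤ b * (1 - y) := by gcongr; exact min_le_right _ _
  rcases eq_or_ne (min x (1 - x)) (min y (1 - y)) with h | h
  · have hlt : min x (1 - x) < min (a * x + b * y) (1 - (a * x + b * y)) := by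
      obtain rfl : b = 1 - a := by linarith
      rcases min_cases x (1 - x) with ⟨h1, h1'⟩ | ⟨h1, h1'⟩ <;>
      rcases min_cases y (1 - y) with ⟨h2, h2'⟩ | ⟨h2, h2'⟩ <;> rw [h1, h2] at h
      · exact absurd h hxy
      · have : x ≠ 1 / 2 := fun h' => hxy (by linarith)
        have : x < 1 / 2 := lt_of_le_of_ne (by linarith) this
        obtain rfl : y = 1 - x := by linarith
        rw [h1]
        refine lt_min ?_ ?_ <;> nlinarith
      · obtain rfl : y = 1 - x := by linarith
        rw [h1]
        refine lt_min ?_ ?_ <;> nlinarith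
      · exact absurd (by linarith) hxy
    have := hmono (hmem x hx) (hmem _ hz) (mul_lt_mul_of_pos_left hlt pi_pos)
    rw [← h, ← add_mul, hab, one_mul]
    exact this
  · have hne : π * min x (1 - x) ≠ π * min y (1 - y) := by simpa [pi_ne_zero] using h
    refine (hg.2 (hmem x hx) (hmem y hy) hne ha hb hab).trans_le ?_
    refine hmono.monotoneOn (hg.1 (hmem x hx) (hmem y hy) ha.le hb.le hab) (hmem _ hz) ?_
    simp only [smul_eq_mul]
    have : a * min x (1 - x) + b * min y (1 - y) ≤ min (a * x + b * y) (1 - (a * x + b * y)) :=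
      le_min (by linarith) (by linarith)
    nlinarith [pi_pos]

theorem arccos_one_sub_sq_div_two {d : ℝ} (h0 : 0 ≤ d) (h2 : d ≤ 2) :
    arccos (1 - d ^ 2 / 2) = 2 * arcsin (d / 2) := by
  have hcos : cos (2 * arcsin (d / 2)) = 1 - d ^ 2 / 2 := by
    rw [cos_two_mul, cos_sq', sin_arcsin (by linarith) (by linarith)]
    ring
  rw [← hcos, arccos_cos]
  · have := arcsin_nonneg.2 (by linarith : 0 ≤ d / 2)
    linarith
  · linarith [arcsin_le_pi_div_two (d / 2)]

theorem sin_pi_mul_min (z : ℝ) : sin (π * min z (1 - z)) = sin (π * z) := by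
  rcases min_choice z (1 - z) with h | h <;> rw [h]
  rw [mul_sub, mul_one, sin_pi_sub]

/-- Fix `a > 0` and let `φ(z) = a⁻¹ arctan((a/π) sin(πz))`.  For every `L > 0` such that
`Lφ(z) ≤ 2` on `[0,1]`, the function `z ↦ arccos(1 − L²φ(z)²/2)` (the spherical distance
corresponding to the Euclidean chord `Lφ(z)` on the unit sphere) is strictly concave
on `(0,1)`. -/
theorem arccos_phi_strictConcave (a : ℝ) (ha : 0 < a) (L : ℝ) (hL : 0 < L)
    (hsmall : ∀ z ∈ Set.Icc (0 : ℝ) 1, L * phi a z ≤ 2) :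
    StrictConcaveOn ℝ (Set.Ioo 0 1)
      (fun z => Real.arccos (1 - L ^ 2 * (phi a z) ^ 2 / 2)) := by
  have hc : 0 < L * a⁻¹ / 2 := by positivity
  have hk : 0 < a / π := by positivity
  have hck : L * a⁻¹ / 2 * arctan (a / π) ≤ 1 := by
    have h := hsmall (1 / 2) ⟨by norm_num, by norm_num⟩
    rw [phi, mul_one_div, sin_pi_div_two, mul_one] at h
    linarith
  have hconc := (strictConcaveOn_arcsin_mul_arctan_mul_sin hc hk hck).comp_pi_mul_min
    (strictMonoOn_arcsin_mul_arctan_mul_sin hc hk hck)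
  have htwo := hconc.add hconc
  refine htwo.congr fun z hz => ?_
  have hs : 0 < sin (π * z) :=
    sin_pos_of_pos_of_lt_pi (mul_pos pi_pos hz.1) (by nlinarith [hz.2, pi_pos])
  have hphi : 0 ≤ L * phi a z := by
    have : 0 < arctan (a / π * sin (π * z)) := arctan_pos.2 (by positivity)
    unfold phi
    positivity
  rw [← mul_pow, arccos_one_sub_sq_div_two hphi (hsmall z ⟨hz.1.le, hz.2.le⟩)]
  simp only [Pi.add_apply, sin_pi_mul_min, phi]
  rw [← two_mul]
  ring_nf
end

section
/- For all real numbers X, Y with 0 < X < Y, the quantity q(X,Y) := (1/(1 + Y²)) · ((Y² − X²)/((arctan Y)² − (arctan X)²)) · (arctan(X)/X) is strictly less than 1. -/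
open Real

theorem arctan_lt_self {x : ℝ} (hx : 0 < x) : arctan x < x := by
  simpa only [tan_arctan] using lt_tan (arctan_pos.2 hx) (arctan_lt_pi_div_two x)

theorem strictMonoOn_arctan_sq_add_arctan_div :
    StrictMonoOn (fun t : ℝ => arctan t ^ 2 + arctan t / t) (Set.Ioi 0) := by
  have hder (t : ℝ) (ht : 0 < t) : HasDerivAt (fun t : ℝ => arctan t ^ 2 + arctan t / t)
      ((t - arctan t * (1 - t ^ 2)) / (t ^ 2 * (1 + t ^ 2))) t := by
    refine (((hasDerivAt_arctan t).pow 2).add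
      ((hasDerivAt_arctan t).div (hasDerivAt_id t) ht.ne')).congr_deriv ?_
    simp only [id]
    field_simp
    ring
  refine strictMonoOn_of_hasDerivWithinAt_pos (convex_Ioi 0)
    (fun t ht => (hder t ht).continuousAt.continuousWithinAt)
    (fun t ht => (hder t (by simpa using ht)).hasDerivWithinAt) fun t ht => ?_
  have ht : 0 < t := by simpa using ht
  have := arctan_lt_self ht
  have : 0 < arctan t * t ^ 2 := mul_pos (arctan_pos.2 ht) (by positivity)
  exact div_pos (by linarith) (by positivity)

theorem arctan_mul_sq_sub_sq_lt {x y : ℝ} (hx : 0 < x) (hxy : x < y) :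
    arctan x * (y ^ 2 - x ^ 2) < x * (1 + y ^ 2) * (arctan y ^ 2 - arctan x ^ 2) := by
  let F : ℝ → ℝ := fun t =>
    x * (1 + t ^ 2) * (arctan t ^ 2 - arctan x ^ 2) - arctan x * (t ^ 2 - x ^ 2)
  have hder (t : ℝ) : HasDerivAt F
      (2 * (x * t * (arctan t ^ 2 - arctan x ^ 2) + x * arctan t - arctan x * t)) t := by
    have hsq : HasDerivAt (fun t : ℝ => t ^ 2) (2 * t) t := by simpa using hasDerivAt_pow 2 t
    refine ((((hsq.const_add 1).const_mul x).mul
      (((hasDerivAt_arctan t).pow 2).sub_const (arctan x ^ 2))).sub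
      ((hsq.sub_const (x ^ 2)).const_mul (arctan x))).congr_deriv ?_
    simp only [Pi.pow_apply]
    field_simp
    ring
  have hmono : StrictMonoOn F (Set.Ici x) := by
    refine strictMonoOn_of_hasDerivWithinAt_pos (convex_Ici x)
      (fun t _ => (hder t).continuousAt.continuousWithinAt)
      (fun t _ => (hder t).hasDerivWithinAt) fun t ht => ?_
    have hxt : x < t := by simpa using ht
    have ht : 0 < t := hx.trans hxt
    have h := sub_pos.2 (strictMonoOn_arctan_sq_add_arctan_div hx ht hxt)
    refine (mul_pos (mul_pos two_pos (mul_pos hx ht)) h).trans_eq ?_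
    field_simp
    ring
  have h := hmono Set.self_mem_Ici hxy.le hxy
  simp only [F, sub_self, mul_zero] at h
  exact sub_pos.1 h

/-- For all `0 < X < Y`, the quantity
`q(X,Y) = (1/(1+Y²)) · ((Y² − X²)/((arctan Y)² − (arctan X)²)) · (arctan X / X)`
is strictly less than `1`. -/
theorem q_lt_one (X Y : ℝ) (hX : 0 < X) (hXY : X < Y) :
    1 / (1 + Y ^ 2) * ((Y ^ 2 - X ^ 2) / ((Real.arctan Y) ^ 2 - (Real.arctan X) ^ 2)) *
      (Real.arctan X / X) < 1 := by
  have hsub : 0 < arctan Y ^ 2 - arctan X ^ 2 :=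
    sub_pos.2 (pow_lt_pow_left₀ (arctan_strictMono hXY) (arctan_nonneg.2 hX.le) two_ne_zero)
  rw [div_mul_div_comm, div_mul_div_comm, div_lt_one (by positivity)]
  linarith [arctan_mul_sq_sub_sq_lt hX hXY]
end

section
/- For every X > 0, one has arctan(X) / ( X (π²/4 − (arctan X)²) ) < 1. Equivalently, writing X = cot θ with θ ∈ (0, π/2), one has ((π/2 − θ) tan θ)/(θ(π − θ)) < 1. -/
open Real

/-- On `(0, π/2)`, the function `tan` is bounded by `θ (π - θ) / (π/2 - θ)`. -/
theorem pi_div_two_sub_mul_tan_lt {θ : ℝ} (h0 : 0 < θ) (h1 : θ < π / 2) :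
    (π / 2 - θ) * Real.tan θ < θ * (π - θ) := by
  have hcos : 0 < Real.cos θ := Real.cos_pos_of_mem_Ioo ⟨by linarith, h1⟩
  rw [Real.tan_eq_sin_div_cos, ← mul_div_assoc, div_lt_iff₀ hcos]
  have hle : π / 2 - θ ≤ (π - θ) * Real.cos θ := by
    have hjordan := Real.one_sub_mul_le_cos h0.le h1.le
    calc π / 2 - θ = π / 2 * (1 - 2 / π * θ) := by field_simp
      _ ≤ π / 2 * Real.cos θ := by gcongr
      _ ≤ (π - θ) * Real.cos θ := by gcongr; linarith
  calc (π / 2 - θ) * Real.sin θ < (π / 2 - θ) * θ :=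
        mul_lt_mul_of_pos_left (Real.sin_lt h0) (by linarith)
    _ ≤ ((π - θ) * Real.cos θ) * θ := by gcongr
    _ = θ * (π - θ) * Real.cos θ := by ring

/-- For every `X > 0`, `arctan X / (X(π²/4 − (arctan X)²)) < 1`; equivalently, writing
`X = cot θ` with `θ ∈ (0, π/2)`, `((π/2 − θ) tan θ)/(θ(π − θ)) < 1`. -/
theorem arctan_quotient_lt_one :
    (∀ X : ℝ, 0 < X →
        Real.arctan X / (X * (π ^ 2 / 4 - (Real.arctan X) ^ 2)) < 1) ∧
    (∀ θ ∈ Set.Ioo (0 : ℝ) (π / 2),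
        (π / 2 - θ) * Real.tan θ / (θ * (π - θ)) < 1) := by
  refine ⟨fun X hX => ?_, fun θ hθ => ?_⟩
  · have ha := Real.arctan_pos.2 hX
    have ha' := Real.arctan_lt_pi_div_two X
    have h := pi_div_two_sub_mul_tan_lt (θ := π / 2 - Real.arctan X)
      (by linarith) (by linarith)
    rw [Real.tan_pi_div_two_sub, Real.tan_arctan, sub_sub_cancel, ← div_eq_mul_inv,
      div_lt_iff₀ hX] at h
    rw [div_lt_one (mul_pos hX (by nlinarith))]
    linarith
  · obtain ⟨h0, h1⟩ := hθ
    rw [div_lt_one (mul_pos h0 (by linarith))]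
    exact pi_div_two_sub_mul_tan_lt h0 h1
end

section
/- The function h(X) := X / ((1 + X²) arctan X) is strictly decreasing on (0, ∞); indeed its logarithmic derivative satisfies (log h)'(X) = 1/X − 1/((1 + X²) arctan X) − 2X/(1 + X²) ≤ −X/(1 + X²) < 0 for all X > 0. -/
open Real

lemma arctan_le_self_of_pos {x : ℝ} (hx : 0 < x) : arctan x ≤ x := by
  simpa only [tan_arctan] using
    (lt_tan (arctan_pos.2 hx) (arctan_lt_pi_div_two x)).le

lemma hasDerivAt_log_div_one_add_sq_mul_arctan {x : ℝ} (hx : 0 < x) :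
    HasDerivAt (fun x : ℝ => log (x / ((1 + x ^ 2) * arctan x)))
      (1 / x - 1 / ((1 + x ^ 2) * arctan x) - 2 * x / (1 + x ^ 2)) x := by
  have ha : 0 < arctan x := arctan_pos.2 hx
  have hs : HasDerivAt (fun x : ℝ => 1 + x ^ 2) (2 * x) x := by
    simpa using (hasDerivAt_pow 2 x).const_add 1
  have hden : HasDerivAt (fun x : ℝ => (1 + x ^ 2) * arctan x)
      (2 * x * arctan x + (1 + x ^ 2) * (1 / (1 + x ^ 2))) x := hs.mul (hasDerivAt_arctan x)
  have hquot : HasDerivAt (fun x : ℝ => x / ((1 + x ^ 2) * arctan x)) _ x :=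
    (hasDerivAt_id' x).div hden (by positivity)
  convert hquot.log (by positivity) using 1
  field_simp
  ring

lemma logDeriv_bound_of_pos {x : ℝ} (hx : 0 < x) :
    1 / x - 1 / ((1 + x ^ 2) * arctan x) - 2 * x / (1 + x ^ 2) ≤ -x / (1 + x ^ 2) := by
  have ha : 0 < arctan x := arctan_pos.2 hx
  have hle : 1 / ((1 + x ^ 2) * x) ≤ 1 / ((1 + x ^ 2) * arctan x) := by
    gcongr
    exact arctan_le_self_of_pos hx
  have hsplit : 1 / x - 2 * x / (1 + x ^ 2) + x / (1 + x ^ 2) = 1 / ((1 + x ^ 2) * x) := by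
    field_simp
    ring
  rw [neg_div]
  linarith

/-- The function `h(X) = X / ((1 + X²) arctan X)` is strictly decreasing on `(0, ∞)`;
indeed its logarithmic derivative equals
`1/X − 1/((1 + X²) arctan X) − 2X/(1 + X²)`, which is at most `−X/(1 + X²) < 0`
for all `X > 0`. -/
theorem h_strictAnti :
    StrictAntiOn (fun X : ℝ => X / ((1 + X ^ 2) * Real.arctan X)) (Set.Ioi 0) ∧
    ∀ X : ℝ, 0 < X →
      deriv (fun X : ℝ => Real.log (X / ((1 + X ^ 2) * Real.arctan X))) X
          = 1 / X - 1 / ((1 + X ^ 2) * Real.arctan X) - 2 * X / (1 + X ^ 2) ∧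
      1 / X - 1 / ((1 + X ^ 2) * Real.arctan X) - 2 * X / (1 + X ^ 2)
          ≤ -X / (1 + X ^ 2) ∧
      -X / (1 + X ^ 2) < 0 := by
  have hneg {X : ℝ} (hX : 0 < X) : -X / (1 + X ^ 2) < 0 :=
    div_neg_of_neg_of_pos (neg_neg_of_pos hX) (by positivity)
  have hpos {X : ℝ} (hX : 0 < X) : 0 < X / ((1 + X ^ 2) * arctan X) := by
    have := arctan_pos.2 hX
    positivity
  refine ⟨fun a ha b hb hab => ?_, fun X hX =>
    ⟨(hasDerivAt_log_div_one_add_sq_mul_arctan hX).deriv, logDeriv_bound_of_pos hX, hneg hX⟩⟩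
  have hlog : StrictAntiOn (fun X : ℝ => log (X / ((1 + X ^ 2) * arctan X))) (Set.Ioi 0) := by
    refine strictAntiOn_of_deriv_neg (convex_Ioi 0) (fun X hX =>
      (hasDerivAt_log_div_one_add_sq_mul_arctan hX).continuousAt.continuousWithinAt)
      fun X hX => ?_
    rw [interior_Ioi] at hX
    rw [(hasDerivAt_log_div_one_add_sq_mul_arctan hX).deriv]
    exact (logDeriv_bound_of_pos hX).trans_lt (hneg hX)
  exact (log_lt_log_iff (hpos hb) (hpos ha)).1 (hlog ha hb hab)
end

section
/- Let x, y ∈ S² = {v ∈ ℝ³ : |v| = 1} with x ≠ y and x + y ≠ 0; set d := |x − y| and w := (x − y)/d. Suppose T_x, T_y ∈ ℝ³ are unit vectors with ⟨T_x, x⟩ = 0, ⟨T_y, y⟩ = 0, and ⟨w, T_x⟩ = ⟨w, T_y⟩ = −p for some real p. Then either ⟨T_x, T_y⟩ = p² (1 − d²/2)/(1 − d²/4) + (1 − p²/(1 − d²/4)), or ⟨T_x, T_y⟩ = p² (1 − d²/2)/(1 − d²/4) − (1 − p²/(1 − d²/4)). -/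
open Real
open scoped RealInnerProductSpace

/-- In `ℝ³`, the Gram determinants of `(x, y, u)` and `(x, y, v)` multiply to the square of the
mixed Gram determinant: all three are products of the triple products of `(x, y, u)` and
`(x, y, v)`. -/
theorem gram_mul_gram_eq_mixed_gram_sq (x y u v : EuclideanSpace ℝ (Fin 3)) :
    (!![⟪x, x⟫, ⟪x, y⟫, ⟪x, u⟫; ⟪y, x⟫, ⟪y, y⟫, ⟪y, u⟫; ⟪u, x⟫, ⟪u, y⟫, ⟪u, u⟫]).det *
      (!![⟪x, x⟫, ⟪x, y⟫, ⟪x, v⟫; ⟪y, x⟫, ⟪y, y⟫, ⟪y, v⟫; ⟪v, x⟫, ⟪v, y⟫, ⟪v, v⟫]).det =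
    (!![⟪x, x⟫, ⟪x, y⟫, ⟪x, v⟫; ⟪y, x⟫, ⟪y, y⟫, ⟪y, v⟫; ⟪u, x⟫, ⟪u, y⟫, ⟪u, v⟫]).det ^ 2 := by
  have gram (a b : EuclideanSpace ℝ (Fin 3)) :
      (!![⟪x, x⟫, ⟪x, y⟫, ⟪x, b⟫; ⟪y, x⟫, ⟪y, y⟫, ⟪y, b⟫; ⟪a, x⟫, ⟪a, y⟫, ⟪a, b⟫]).det =
      (!![x 0, x 1, x 2; y 0, y 1, y 2; a 0, a 1, a 2]).det *
        (!![x 0, x 1, x 2; y 0, y 1, y 2; b 0, b 1, b 2]).det := by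
    have inner_eq (v w : EuclideanSpace ℝ (Fin 3)) :
        ⟪v, w⟫ = v 0 * w 0 + v 1 * w 1 + v 2 * w 2 := by
      simp [PiLp.inner_apply, Fin.sum_univ_three, mul_comm]
    simp only [Matrix.det_fin_three, Matrix.of_apply, Matrix.cons_val', Matrix.cons_val, inner_eq]
    ring
  rw [gram, gram, gram]
  ring

/-- Relative configuration of unit tangent vectors at a critical point of the chord-arc
difference: if `x ≠ y`, `x + y ≠ 0` are points of the unit sphere `S² ⊂ ℝ³`, `d = |x − y|`,
`w = (x − y)/d`, and `T_x, T_y` are unit vectors with `⟨T_x, x⟩ = ⟨T_y, y⟩ = 0` and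
`⟨w, T_x⟩ = ⟨w, T_y⟩ = −p`, then
`⟨T_x, T_y⟩ = p²(1 − d²/2)/(1 − d²/4) ± (1 − p²/(1 − d²/4))`. -/
theorem tangent_configuration (x y Tx Ty : EuclideanSpace ℝ (Fin 3)) (p d : ℝ)
    (hx : ‖x‖ = 1) (hy : ‖y‖ = 1) (hxy : x ≠ y) (hxy' : x + y ≠ 0)
    (hd : d = ‖x - y‖)
    (hTx : ‖Tx‖ = 1) (hTy : ‖Ty‖ = 1)
    (hTxx : ⟪Tx, x⟫ = 0) (hTyy : ⟪Ty, y⟫ = 0)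
    (hwTx : ⟪d⁻¹ • (x - y), Tx⟫ = -p)
    (hwTy : ⟪d⁻¹ • (x - y), Ty⟫ = -p) :
    ⟪Tx, Ty⟫ = p ^ 2 * (1 - d ^ 2 / 2) / (1 - d ^ 2 / 4) + (1 - p ^ 2 / (1 - d ^ 2 / 4)) ∨
    ⟪Tx, Ty⟫ = p ^ 2 * (1 - d ^ 2 / 2) / (1 - d ^ 2 / 4) - (1 - p ^ 2 / (1 - d ^ 2 / 4)) := by
  have hd0 : 0 < d := hd ▸ norm_pos_iff.2 (sub_ne_zero.2 hxy)
  have hc : ⟪x, y⟫ = 1 - d ^ 2 / 2 := by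
    rw [hd, norm_sub_sq_real, hx, hy]
    ring
  have hs : 0 < 1 - d ^ 2 / 4 := by
    have h : ‖x + y‖ ^ 2 = 4 * (1 - d ^ 2 / 4) := by
      rw [norm_add_sq_real, hx, hy, hc]
      ring
    have : 0 < ‖x + y‖ ^ 2 := by positivity
    linarith
  have hxTy : ⟪x, Ty⟫ = -(p * d) := by
    rw [real_inner_smul_left, inner_sub_left, real_inner_comm Ty y, hTyy] at hwTy
    field_simp at hwTy
    linarith
  have hyTx : ⟪y, Tx⟫ = p * d := by
    rw [real_inner_smul_left, inner_sub_left, real_inner_comm Tx x, hTxx] at hwTx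
    field_simp at hwTx
    linarith
  have hgram := gram_mul_gram_eq_mixed_gram_sq x y Tx Ty
  simp only [Matrix.det_fin_three, Matrix.of_apply, Matrix.cons_val', Matrix.cons_val,
    real_inner_comm x y, real_inner_comm Tx x, real_inner_comm Ty y, real_inner_comm x Ty,
    real_inner_comm y Tx, real_inner_self_eq_norm_sq, hx, hy, hTx, hTy, hTxx, hTyy, hxTy, hyTx,
    hc] at hgram
  have hsq : (⟪Tx, Ty⟫ * (1 - d ^ 2 / 4) - p ^ 2 * (1 - d ^ 2 / 2)) ^ 2 =
      (1 - d ^ 2 / 4 - p ^ 2) ^ 2 := by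
    apply mul_left_cancel₀ (pow_ne_zero 4 hd0.ne')
    linear_combination -hgram
  have hs' := hs.ne'
  rcases sq_eq_sq_iff_eq_or_eq_neg.1 hsq with h | h
  · left
    rw [← mul_left_inj' hs', add_mul, sub_mul, div_mul_cancel₀ _ hs', div_mul_cancel₀ _ hs']
    linarith
  · right
    rw [← mul_left_inj' hs', sub_mul, sub_mul, div_mul_cancel₀ _ hs', div_mul_cancel₀ _ hs']
    linarith
end

section
/- Let γ : ℝ → ℝ³ be a smooth unit-speed L-periodic curve lying on S² = {v ∈ ℝ³ : |v| = 1}, injective on [0, L) (a simple closed spherical curve Γ), with unit tangent T = γ'. Let φ : [0,1] → ℝ be smooth and nonnegative with φ(0) = φ(1) = 0, satisfying: φ(1 − z) = φ(z); |φ'| ≤ 1; φ strictly concave; and, with the given L, L φ(z) ≤ 2 for all z and z ↦ arccos(1 − L²φ(z)²/2) strictly concave on (0,1). Define ℓ(s₁, s₂) as the length of the shorter arc of Γ between γ(s₁) and γ(s₂), and Z(s₁, s₂) := |γ(s₁) − γ(s₂)| − L φ(ℓ(s₁,s₂)/L). If Z ≥ 0 everywhere and Z(s₁, s₂) = 0 at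 some pair with γ(s₁) ≠ γ(s₂), then ⟨T(s₁), T(s₂)⟩ = 2 φ'(ℓ(s₁,s₂)/L)² − 1. -/
open Real
open scoped RealInnerProductSpace

/-- For a unit-speed `L`-periodic parametrisation of a closed curve, the length of the
shorter of the two arcs joining `γ s₁` to `γ s₂` (the distance in `ℝ / Lℤ`). -/
noncomputable def arcDist (L s₁ s₂ : ℝ) : ℝ :=
  sInf {r : ℝ | ∃ n : ℤ, r = |s₂ - s₁ + n * L|}

theorem exists_continuous_complex_log {A : Type*} [TopologicalSpace A] [SimplyConnectedSpace A]
    [LocallyPathConnectedSpace A] {f : A → ℂ} (hf : Continuous f) (h0 : ∀ x, f x ≠ 0) :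
    ∃ F : A → ℂ, Continuous F ∧ ∀ x, Complex.exp (F x) = f x := by
  obtain ⟨a₀⟩ : Nonempty A := inferInstance
  obtain ⟨F, ⟨-, hF⟩, -⟩ := Complex.isCoveringMap_exp.existsUnique_continuousMap_lifts
    (⟨fun x => ⟨f x, h0 x⟩, by fun_prop⟩ : C(A, {z : ℂ // z ≠ 0})) a₀ (Complex.log (f a₀))
    (Subtype.ext (Complex.exp_log (h0 a₀)))
  exact ⟨F, F.continuous, fun x => congrArg Subtype.val (congrFun hF x)⟩

/-- The mean velocity of `z` over the interval from `s` to `t`. -/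
noncomputable def meanVelocity (z : ℝ → ℂ) (s t : ℝ) : ℂ :=
  ∫ r in (0 : ℝ)..1, deriv z (s + r * (t - s))

theorem continuous_meanVelocity {z : ℝ → ℂ} (hz : ContDiff ℝ 1 z) :
    Continuous fun p : ℝ × ℝ => meanVelocity z p.1 p.2 := by
  have := hz.continuous_deriv le_rfl
  refine intervalIntegral.continuous_parametric_intervalIntegral_of_continuous' ?_ 0 1
  fun_prop

theorem meanVelocity_self (z : ℝ → ℂ) (s : ℝ) : meanVelocity z s s = deriv z s := by
  simp [meanVelocity]

theorem sub_mul_meanVelocity {z : ℝ → ℂ} (hz : ContDiff ℝ 1 z) (s t : ℝ) :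
    ((t - s : ℝ) : ℂ) * meanVelocity z s t = z t - z s := by
  have hd : ∀ r : ℝ, HasDerivAt (fun r : ℝ => z (s + r * (t - s)))
      ((t - s) • deriv z (s + r * (t - s))) r := fun r =>
    HasDerivAt.scomp r ((hz.differentiable one_ne_zero).differentiableAt.hasDerivAt)
      (by simpa using ((hasDerivAt_id r).mul_const (t - s)).const_add s)
  have hc := hz.continuous_deriv le_rfl
  have := intervalIntegral.integral_eq_sub_of_hasDerivAt (a := 0) (b := 1)
    (fun r _ => hd r) (Continuous.intervalIntegrable (by fun_prop) _ _)
  rw [intervalIntegral.integral_smul] at this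
  simpa [meanVelocity] using this

/-- For an `L`-periodic curve `z`, a continuous function on the strip `s ≤ t ≤ s + L` which is a
positive multiple of the chord `z t - z s` in the interior of the strip. -/
noncomputable def chordDir (z : ℝ → ℂ) (L s t : ℝ) : ℂ :=
  meanVelocity z s t - meanVelocity z t (s + L)

section chordDir

variable {z : ℝ → ℂ} {L : ℝ}

theorem continuous_chordDir (hz : ContDiff ℝ 1 z) :
    Continuous fun p : ℝ × ℝ => chordDir z L p.1 p.2 := by
  have h := continuous_meanVelocity hz
  exact (h.comp (by fun_prop : Continuous fun p : ℝ × ℝ => (p.1, p.2))).sub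
    (h.comp (by fun_prop : Continuous fun p : ℝ × ℝ => (p.2, p.1 + L)))

theorem meanVelocity_period (hz : ContDiff ℝ 1 z) (hL : 0 < L) (hper : Function.Periodic z L)
    (s : ℝ) : meanVelocity z s (s + L) = 0 := by
  have h := sub_mul_meanVelocity hz s (s + L)
  rw [hper s, sub_self] at h
  simpa [hL.ne'] using h

theorem chordDir_self (hz : ContDiff ℝ 1 z) (hL : 0 < L) (hper : Function.Periodic z L) (s : ℝ) :
    chordDir z L s s = deriv z s := by
  rw [chordDir, meanVelocity_self, meanVelocity_period hz hL hper, sub_zero]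

theorem chordDir_add_period (hper : Function.Periodic z L) (s t : ℝ) :
    chordDir z L t (s + L) = -chordDir z L s t := by
  have hd : Function.Periodic (deriv z) L := fun x => by
    rw [← deriv_comp_add_const]
    exact congrArg (fun f => deriv f x) (funext hper)
  have : meanVelocity z (s + L) (t + L) = meanVelocity z s t := by
    unfold meanVelocity
    congr 1
    ext r
    rw [← hd (s + r * (t - s))]
    congr 1
    ring
  rw [chordDir, this, chordDir, neg_sub]

theorem chordDir_eq (hz : ContDiff ℝ 1 z) (hper : Function.Periodic z L) {s t : ℝ}
    (hst : s < t) (hts : t < s + L) :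
    chordDir z L s t = ((L / ((t - s) * (s + L - t)) : ℝ) : ℂ) * (z t - z s) := by
  have h1 := sub_mul_meanVelocity hz s t
  have h2 := sub_mul_meanVelocity hz t (s + L)
  rw [hper s] at h2
  have e1 : ((t - s : ℝ) : ℂ) ≠ 0 := by exact_mod_cast (sub_pos.2 hst).ne'
  have e2 : ((s + L - t : ℝ) : ℂ) ≠ 0 := by exact_mod_cast (sub_pos.2 hts).ne'
  rw [mul_comm, ← eq_div_iff e1] at h1
  rw [mul_comm, ← eq_div_iff e2] at h2
  rw [chordDir, h1, h2, Complex.ofReal_div, Complex.ofReal_mul]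
  field_simp
  push_cast
  ring

/-- A continuous logarithm of the chord direction on the strip `s ≤ t ≤ s + L`. -/
theorem exists_log_chordDir (hz : ContDiff ℝ 1 z) (hL : 0 < L) (hper : Function.Periodic z L)
    (hinj : ∀ s t, s < t → t < s + L → z t ≠ z s) (hd : ∀ s, deriv z s ≠ 0) :
    ∃ Λ : ℝ × ℝ → ℂ, Continuous Λ ∧
      ∀ s t, s ≤ t → t ≤ s + L → Complex.exp (Λ (s, t)) = chordDir z L s t := by
  have h0 : ∀ s t, s ≤ t → t ≤ s + L → chordDir z L s t ≠ 0 := by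
    intro s t h1 h2
    rcases h1.eq_or_lt with rfl | h1
    · rw [chordDir_self hz hL hper]; exact hd s
    rcases h2.eq_or_lt with rfl | h2
    · rw [chordDir_add_period hper, chordDir_self hz hL hper]; exact neg_ne_zero.2 (hd s)
    rw [chordDir_eq hz hper h1 h2]
    refine mul_ne_zero ?_ (sub_ne_zero.2 (hinj s t h1 h2))
    have : 0 < L / ((t - s) * (s + L - t)) :=
      div_pos hL (mul_pos (sub_pos.2 h1) (sub_pos.2 h2))
    exact_mod_cast this.ne'
  obtain ⟨Λ, hΛ, hexp⟩ := exists_continuous_complex_log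
    (f := fun p : ℝ × ℝ => chordDir z L p.1 (max p.1 (min p.2 (p.1 + L))))
    ((continuous_chordDir hz).comp
      (by fun_prop : Continuous fun p : ℝ × ℝ => (p.1, max p.1 (min p.2 (p.1 + L)))))
    (fun p => h0 _ _ (le_max_left _ _) (max_le (by linarith) (min_le_right _ _)))
  refine ⟨Λ, hΛ, fun s t h1 h2 => ?_⟩
  rw [hexp]
  simp [h1, h2]

end chordDir

theorem mul_pos_of_forall_ne_zero {g : ℝ → ℝ} {a b : ℝ} (hab : a ≤ b) (hg : Continuous g)
    (h0 : ∀ s ∈ Set.Icc a b, g s ≠ 0) : 0 < g a * g b := by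
  by_contra! h
  obtain ⟨s, hs, hs0⟩ : (0 : ℝ) ∈ g '' Set.Icc a b := by
    rcases mul_nonpos_iff.1 h with ⟨h1, h2⟩ | ⟨h1, h2⟩
    · exact intermediate_value_Icc' hab hg.continuousOn ⟨h2, h1⟩
    · exact intermediate_value_Icc hab hg.continuousOn ⟨h1, h2⟩
  exact h0 s hs hs0

theorem sin_half_ne_zero_of_sin_ne_zero {x : ℝ} (h : sin x ≠ 0) : sin (x / 2) ≠ 0 := by
  intro h0
  apply h
  rw [show x = 2 * (x / 2) by ring, sin_two_mul, h0]
  ring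

theorem Complex.exp_eq_pos_mul_exp {x y : ℂ} {n : ℤ} (h : n * π = (x.im - y.im) / 2) :
    Complex.exp x = (Real.exp (x.re - y.re) : ℝ) * Complex.exp y := by
  have hx : x = ((x.re - y.re : ℝ) : ℂ) + y + n * (2 * π * Complex.I) := by
    apply Complex.ext
    · simp
    · simp
      linarith
  rw [hx, Complex.exp_periodic.int_mul n, Complex.exp_add, Complex.ofReal_exp]
  simp

section crossing

variable {z : ℝ → ℂ} {L : ℝ} {Λ : ℝ × ℝ → ℂ}

theorem sin_half_mul_pos (hz : ContDiff ℝ 1 z) (hL : 0 < L) (hper : Function.Periodic z L)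
    (hΛ : Continuous Λ)
    (hexp : ∀ s t, s ≤ t → t ≤ s + L → Complex.exp (Λ (s, t)) = chordDir z L s t)
    {p q : ℝ} (hpq : p < q) (hqp : q < p + L)
    (hcross : ∀ s ∈ Set.Ioo p q, ∀ r : ℝ, 0 < r → z s - z p ≠ r * (z q - z s))
    (hp : sin ((Λ (p, p)).im - (Λ (p, q)).im) ≠ 0)
    (hq : sin ((Λ (p, q)).im - (Λ (q, q)).im) ≠ 0) :
    0 < sin (((Λ (p, p)).im - (Λ (p, q)).im) / 2) *
      sin (((Λ (p, q)).im - (Λ (q, q)).im) / 2) := by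
  refine mul_pos_of_forall_ne_zero (g := fun s => sin (((Λ (p, s)).im - (Λ (s, q)).im) / 2))
    hpq.le ?_ ?_
  · have h1 : Continuous fun s => Λ (p, s) := by fun_prop
    have h2 : Continuous fun s => Λ (s, q) := by fun_prop
    fun_prop
  intro s hs
  rcases hs.1.eq_or_lt with rfl | h1
  · exact sin_half_ne_zero_of_sin_ne_zero hp
  rcases hs.2.eq_or_lt with rfl | h2
  · exact sin_half_ne_zero_of_sin_ne_zero hq
  intro h0
  obtain ⟨n, hn⟩ := sin_eq_zero_iff.1 h0
  have h := Complex.exp_eq_pos_mul_exp hn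
  rw [hexp _ _ h1.le (by linarith), hexp _ _ h2.le (by linarith),
    chordDir_eq hz hper h1 (by linarith), chordDir_eq hz hper h2 (by linarith)] at h
  have c1 : 0 < L / ((s - p) * (p + L - s)) :=
    div_pos hL (mul_pos (by linarith) (by linarith))
  have c2 : 0 < L / ((q - s) * (s + L - q)) :=
    div_pos hL (mul_pos (by linarith) (by linarith))
  have c3 := Real.exp_pos ((Λ (p, s)).re - (Λ (s, q)).re)
  set u := L / ((s - p) * (p + L - s))
  set v := L / ((q - s) * (s + L - q))
  set w := Real.exp ((Λ (p, s)).re - (Λ (s, q)).re)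
  refine hcross s ⟨h1, h2⟩ (w * v / u) (by positivity) ?_
  have : (u : ℂ) ≠ 0 := by exact_mod_cast c1.ne'
  push_cast
  field_simp
  linear_combination h

theorem im_log_chordDir_add_period (hL : 0 < L) (hper : Function.Periodic z L)
    (hΛ : Continuous Λ)
    (hexp : ∀ s t, s ≤ t → t ≤ s + L → Complex.exp (Λ (s, t)) = chordDir z L s t) (a : ℝ) :
    ∃ k : ℤ, ∀ t ∈ Set.Icc a (a + L),
      (Λ (t, a + L)).im = (Λ (a, t)).im + π + k * (2 * π) := by
  have key : ∀ t ∈ Set.Icc a (a + L), ∃ n : ℤ,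
      Λ (t, a + L) = Λ (a, t) + π * Complex.I + n * (2 * π * Complex.I) := by
    intro t ht
    rw [← Complex.exp_eq_exp_iff_exists_int, hexp _ _ ht.2 (by linarith [ht.1]), Complex.exp_add,
      Complex.exp_pi_mul_I, hexp _ _ ht.1 ht.2, chordDir_add_period hper, mul_neg_one]
  choose! n hn using key
  have him : ∀ t ∈ Set.Icc a (a + L),
      (Λ (t, a + L)).im = (Λ (a, t)).im + π + n t * (2 * π) := by
    intro t ht
    have := congrArg Complex.im (hn t ht)
    simpa using this
  have hcont : ContinuousOn n (Set.Icc a (a + L)) := by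
    have h1 : Continuous fun t => ((Λ (t, a + L)).im - (Λ (a, t)).im - π) / (2 * π) := by
      have h1 : Continuous fun s => Λ (a, s) := by fun_prop
      have h2 : Continuous fun s => Λ (s, a + L) := by fun_prop
      fun_prop
    rw [Int.isClosedEmbedding_coe_real.isInducing.continuousOn_iff]
    refine h1.continuousOn.congr fun t ht => ?_
    have := pi_pos
    simp only [Function.comp, him t ht]
    field_simp
    ring
  refine ⟨n a, fun t ht => ?_⟩
  rw [him t ht, isPreconnected_Icc.constant hcont ht (Set.left_mem_Icc.2 (by linarith))]

/-- If a simple closed plane curve passes through the end points of a chord in directions pointing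
to the same side of the chord, then it meets the interior of the chord. -/
theorem exists_mem_chord (hz : ContDiff ℝ 1 z) (hL : 0 < L) (hper : Function.Periodic z L)
    (hinj : ∀ s t, s < t → t < s + L → z t ≠ z s) (hd : ∀ s, deriv z s ≠ 0)
    {a b : ℝ} (hab : a < b) (hba : b < a + L)
    (hside : 0 < (deriv z a / (z b - z a)).im * (deriv z b / (z b - z a)).im) :
    ∃ s, (s ∈ Set.Ioo a b ∨ s ∈ Set.Ioo b (a + L)) ∧
      ∃ r : ℝ, 0 < r ∧ z s - z a = r * (z b - z s) := by
  by_contra! hcross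
  obtain ⟨Λ, hΛ, hexp⟩ := exists_log_chordDir hz hL hper hinj hd
  obtain ⟨k, hk⟩ := im_log_chordDir_add_period hL hper hΛ hexp a
  have hA : ∀ s, s ∈ Set.Icc a b → ∃ c : ℝ, 0 < c ∧
      (deriv z s / (z b - z a)).im = c * sin ((Λ (s, s)).im - (Λ (a, b)).im) := by
    intro s hs
    have c1 : 0 < L / ((b - a) * (a + L - b)) :=
      div_pos hL (mul_pos (by linarith) (by linarith))
    refine ⟨L / ((b - a) * (a + L - b)) * Real.exp ((Λ (s, s)).re - (Λ (a, b)).re),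
      mul_pos c1 (exp_pos _), ?_⟩
    have h1 := hexp s s le_rfl (by linarith)
    have h2 := hexp a b hab.le hba.le
    rw [chordDir_self hz hL hper] at h1
    rw [chordDir_eq hz hper hab hba] at h2
    set u := L / ((b - a) * (a + L - b))
    have hu : (u : ℂ) ≠ 0 := by exact_mod_cast c1.ne'
    rw [← h1, show z b - z a = Complex.exp (Λ (a, b)) / u by rw [h2]; field_simp,
      div_div_eq_mul_div, mul_comm, mul_div_assoc, ← Complex.exp_sub, Complex.im_ofReal_mul,
      Complex.exp_im, Complex.sub_re, Complex.sub_im, mul_assoc]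
  obtain ⟨ca, hca, hA1⟩ := hA a ⟨le_rfl, hab.le⟩
  obtain ⟨cb, hcb, hB1⟩ := hA b ⟨hab.le, le_rfl⟩
  rw [hA1, hB1] at hside
  set A := (Λ (a, a)).im - (Λ (a, b)).im with hAdef
  set B := (Λ (b, b)).im - (Λ (a, b)).im with hBdef
  have hAB : 0 < sin A * sin B := by
    have : 0 < (ca * cb) * (sin A * sin B) := by linarith
    exact (pos_iff_pos_of_mul_pos this).1 (mul_pos hca hcb)
  have hsA : sin A ≠ 0 := left_ne_zero_of_mul hAB.ne'
  have hsB : sin B ≠ 0 := right_ne_zero_of_mul hAB.ne'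
  have e1 : (Λ (a, b)).im - (Λ (b, b)).im = -B := by rw [hBdef]; ring
  have h1 := sin_half_mul_pos hz hL hper hΛ hexp hab hba
    (fun s hs r hr => (hcross s (Or.inl hs) r hr)) hsA (by rwa [e1, sin_neg, neg_ne_zero])
  have hkb := hk b ⟨hab.le, hba.le⟩
  have hka := hk a ⟨le_rfl, by linarith⟩
  have hkL := hk (a + L) ⟨by linarith, le_rfl⟩
  have e2 : (Λ (b, b)).im - (Λ (b, a + L)).im = B - π - k * (2 * π) := by
    rw [hkb, hBdef]; ring
  have e3 : (Λ (b, a + L)).im - (Λ (a + L, a + L)).im = -(A + π + k * (2 * π)) := by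
    rw [hkL, hka, hkb, hAdef]; ring
  have h2 := sin_half_mul_pos hz hL hper hΛ hexp (p := b) (q := a + L) hba (by linarith)
    (fun s hs r hr h => hcross s (Or.inr hs) r⁻¹ (inv_pos.2 hr) (by
      have : (r : ℂ) ≠ 0 := by exact_mod_cast hr.ne'
      rw [hper a] at h
      push_cast
      field_simp
      linear_combination h))
    (by rw [e2, sin_sub_int_mul_two_pi, sin_sub_pi]; exact neg_ne_zero.2 hsB)
    (by rw [e3, sin_neg, sin_add_int_mul_two_pi, sin_add_pi, neg_neg]; exact hsA)
  rw [e1, ← hAdef, neg_div, sin_neg] at h1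
  rw [e2, e3, neg_div, sin_neg,
    show (B - π - k * (2 * π)) / 2 = (B / 2 - π / 2) - k * π by ring,
    show (A + π + k * (2 * π)) / 2 = (A / 2 + π / 2) + k * π by ring,
    sin_sub_int_mul_pi, sin_add_int_mul_pi, sin_sub_pi_div_two, sin_add_pi_div_two] at h2
  have hsq : ((-1 : ℝ) ^ k) * (-1) ^ k = 1 := by
    rw [← mul_zpow]; simp
  have h2' : 0 < cos (A / 2) * cos (B / 2) := by
    have : (-1 : ℝ) ^ k * -cos (B / 2) * -((-1 : ℝ) ^ k * cos (A / 2)) =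
      ((-1 : ℝ) ^ k * (-1) ^ k) * (cos (A / 2) * cos (B / 2)) := by ring
    rwa [this, hsq, one_mul] at h2
  have sA : sin A = 2 * sin (A / 2) * cos (A / 2) := by
    rw [← sin_two_mul]; congr 1; ring
  have sB : sin B = 2 * sin (B / 2) * cos (B / 2) := by
    rw [← sin_two_mul]; congr 1; ring
  rw [sA, sB] at hAB
  nlinarith [mul_pos h1 h2']

end crossing

theorem exists_sphere_coord_crossing {X Y W : ℝ → ℝ} {L : ℝ} (hL : 0 < L)
    (hX : ContDiff ℝ 1 X) (hY : ContDiff ℝ 1 Y) (hW : ContDiff ℝ 1 W)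
    (hXp : Function.Periodic X L) (hYp : Function.Periodic Y L) (hWp : Function.Periodic W L)
    (hsph : ∀ s, X s ^ 2 + Y s ^ 2 + W s ^ 2 = 1) (hW1 : ∀ s, W s < 1)
    (hinj : ∀ s t, s < t → t < s + L → ¬(X t = X s ∧ Y t = Y s ∧ W t = W s))
    (hreg : ∀ s, ¬(deriv X s = 0 ∧ deriv Y s = 0 ∧ deriv W s = 0))
    {a b : ℝ} (hab : a < b) (hba : b < a + L) (hYa : Y a = 0) (hYb : Y b = 0)
    (hXa : 0 < X a) (hXb : 0 < X b) (hWab : W b < W a) (hside : 0 < deriv Y a * deriv Y b) :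
    ∃ s, (s ∈ Set.Ioo a b ∨ s ∈ Set.Ioo b (a + L)) ∧ Y s = 0 ∧ 0 < X s ∧
      W b < W s ∧ W s < W a := by
  have hpos : ∀ s, 0 < 1 - W s := fun s => sub_pos.2 (hW1 s)
  have hne : ∀ s, 1 - W s ≠ 0 := fun s => (hpos s).ne'
  set P : ℝ → ℝ := fun s => X s / (1 - W s) with hP
  set Q : ℝ → ℝ := fun s => Y s / (1 - W s) with hQ
  have hPQ : ∀ s, P s ^ 2 + Q s ^ 2 = (1 + W s) / (1 - W s) := by
    intro s
    have := hne s
    simp only [hP, hQ]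
    field_simp
    linear_combination hsph s
  have hWinj : ∀ s t, (1 + W s) / (1 - W s) < (1 + W t) / (1 - W t) → W s < W t := by
    intro s t h
    rw [div_lt_div_iff₀ (hpos s) (hpos t)] at h
    linarith
  have hdX : ∀ s, HasDerivAt X (deriv X s) s := fun s =>
    (hX.differentiable one_ne_zero).differentiableAt.hasDerivAt
  have hdY : ∀ s, HasDerivAt Y (deriv Y s) s := fun s =>
    (hY.differentiable one_ne_zero).differentiableAt.hasDerivAt
  have hdW : ∀ s, HasDerivAt W (deriv W s) s := fun s =>
    (hW.differentiable one_ne_zero).differentiableAt.hasDerivAt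
  have hdP : ∀ s, HasDerivAt P ((deriv X s * (1 - W s) + X s * deriv W s) / (1 - W s) ^ 2) s :=
    fun s => ((hdX s).div ((hdW s).const_sub 1) (hne s)).congr_deriv (by ring)
  have hdQ : ∀ s, HasDerivAt Q ((deriv Y s * (1 - W s) + Y s * deriv W s) / (1 - W s) ^ 2) s :=
    fun s => ((hdY s).div ((hdW s).const_sub 1) (hne s)).congr_deriv (by ring)
  set z : ℝ → ℂ := fun s => (P s : ℂ) + (Q s : ℂ) * Complex.I with hz
  have hzre : ∀ s, (z s).re = P s := fun s => by simp [hz]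
  have hzim : ∀ s, (z s).im = Q s := fun s => by simp [hz]
  have hdz : ∀ s, deriv z s = (((deriv X s * (1 - W s) + X s * deriv W s) / (1 - W s) ^ 2 : ℝ) : ℂ)
      + (((deriv Y s * (1 - W s) + Y s * deriv W s) / (1 - W s) ^ 2 : ℝ) : ℂ) * Complex.I :=
    fun s => ((hdP s).ofReal_comp.add ((hdQ s).ofReal_comp.mul_const _)).deriv
  have hPc : ContDiff ℝ 1 P := hX.div (contDiff_const.sub hW) hne
  have hQc : ContDiff ℝ 1 Q := hY.div (contDiff_const.sub hW) hne
  have hzc : ContDiff ℝ 1 z :=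
    (Complex.ofRealCLM.contDiff.comp hPc).add
      ((Complex.ofRealCLM.contDiff.comp hQc).mul contDiff_const)
  have hzper : Function.Periodic z L := fun s => by simp only [hz, hP, hQ, hXp s, hYp s, hWp s]
  have hzinj : ∀ s t, s < t → t < s + L → z t ≠ z s := by
    intro s t h1 h2 h
    have hp : P t = P s := by rw [← hzre, ← hzre, h]
    have hq : Q t = Q s := by rw [← hzim, ← hzim, h]
    have hw : W t = W s := by
      have e : (1 + W t) / (1 - W t) = (1 + W s) / (1 - W s) := by rw [← hPQ, ← hPQ, hp, hq]
      rw [div_eq_div_iff (hne t) (hne s)] at e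
      linarith
    simp only [hP, hQ, hw, div_left_inj' (hne s)] at hp hq
    exact hinj s t h1 h2 ⟨hp, hq, hw⟩
  have hzreg : ∀ s, deriv z s ≠ 0 := by
    intro s h
    rw [hdz s] at h
    have hr := congrArg Complex.re h
    have hi := congrArg Complex.im h
    simp only [Complex.add_re, Complex.add_im, Complex.ofReal_re, Complex.ofReal_im,
      Complex.re_ofReal_mul, Complex.im_ofReal_mul, Complex.I_re, Complex.I_im, Complex.zero_re,
      Complex.zero_im, mul_zero, mul_one, add_zero, zero_add, div_eq_zero_iff,
      pow_eq_zero_iff two_ne_zero, hne s, or_false] at hr hi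
    have ht : X s * deriv X s + Y s * deriv Y s + W s * deriv W s = 0 := by
      have h1 := (((hdX s).pow 2).add ((hdY s).pow 2)).add ((hdW s).pow 2)
      have h2 : (X ^ 2 + Y ^ 2 + W ^ 2) = fun _ => (1 : ℝ) := funext hsph
      rw [h2] at h1
      have := h1.unique (hasDerivAt_const s (1 : ℝ))
      simp only [Nat.cast_ofNat, Nat.add_one_sub_one, pow_one] at this
      linarith
    have hw0 : (1 - W s) * deriv W s = 0 := by
      linear_combination X s * hr + Y s * hi - (1 - W s) * ht - deriv W s * hsph s
    have hw := (mul_eq_zero.1 hw0).resolve_left (hne s)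
    rw [hw, mul_zero, add_zero] at hr hi
    exact hreg s ⟨(mul_eq_zero.1 hr).resolve_right (hne s),
      (mul_eq_zero.1 hi).resolve_right (hne s), hw⟩
  have hQa : Q a = 0 := by simp [hQ, hYa]
  have hQb : Q b = 0 := by simp [hQ, hYb]
  have hPa : 0 < P a := div_pos hXa (hpos a)
  have hPb : 0 < P b := div_pos hXb (hpos b)
  have hPab : P b < P a := by
    refine lt_of_pow_lt_pow_left₀ 2 hPa.le ?_
    have ea := hPQ a
    have eb := hPQ b
    rw [hQa] at ea
    rw [hQb] at eb
    have : (1 + W b) / (1 - W b) < (1 + W a) / (1 - W a) := by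
      rw [div_lt_div_iff₀ (hpos b) (hpos a)]
      linarith
    linarith
  have hw : z b - z a = ((P b - P a : ℝ) : ℂ) := by
    simp [hz, hQa, hQb]
  have himdiv : ∀ s, Y s = 0 →
      (deriv z s / (z b - z a)).im = deriv Y s / ((1 - W s) * (P b - P a)) := by
    intro s hs
    rw [hw, Complex.div_ofReal_im, hdz s, hs]
    simp only [Complex.add_im, Complex.ofReal_im, Complex.im_ofReal_mul, Complex.I_im]
    have := hne s
    have : P b - P a ≠ 0 := (sub_neg.2 hPab).ne
    field_simp
    ring
  obtain ⟨s, hs, r, hr, h⟩ := exists_mem_chord hzc hL hzper hzinj hzreg hab hba (by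
    rw [himdiv a hYa, himdiv b hYb, div_mul_div_comm]
    refine div_pos hside ?_
    have : (1 - W a) * (P b - P a) * ((1 - W b) * (P b - P a)) =
      ((1 - W a) * (1 - W b)) * (P b - P a) ^ 2 := by ring
    rw [this]
    exact mul_pos (mul_pos (hpos a) (hpos b)) (sq_pos_of_neg (sub_neg.2 hPab)))
  have hre := congrArg Complex.re h
  have him := congrArg Complex.im h
  simp only [Complex.sub_re, Complex.sub_im, Complex.re_ofReal_mul, Complex.im_ofReal_mul,
    hzre, hzim, hQa, hQb] at hre him
  have hQs : Q s = 0 := by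
    have : (1 + r) * Q s = 0 := by linarith
    exact (mul_eq_zero.1 this).resolve_left (by linarith)
  have hPs1 : P b < P s := by nlinarith
  have hPs2 : P s < P a := by nlinarith
  refine ⟨s, hs, ?_, ?_, hWinj b s ?_, hWinj s a ?_⟩
  · exact (div_eq_zero_iff.1 hQs).resolve_right (hne s)
  · exact (div_pos_iff_of_pos_right (hpos s)).1 (hPb.trans hPs1)
  · rw [← hPQ, ← hPQ, hQb, hQs]; nlinarith
  · rw [← hPQ, ← hPQ, hQa, hQs]; nlinarith

theorem StrictConcaveOn.lt_add_of_nonneg {f : ℝ → ℝ} (hf : StrictConcaveOn ℝ (Set.Ioo 0 1) f)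
    (hc : Continuous f) (h0 : 0 ≤ f 0) {u v : ℝ} (hu : 0 < u) (hv : 0 < v) (huv : u + v < 1) :
    f (u + v) < f u + f v := by
  have key : ∀ h k, 0 < h → h < k → k < u + v - h → f h + f (u + v - h) < f k + f (u + v - k) := by
    intro h k h0 hk hk'
    have hd : 0 < u + v - h - h := by linarith
    set lam := (k - h) / (u + v - h - h) with hlam
    have l0 : 0 < lam := div_pos (by linarith) hd
    have l1 : lam < 1 := by rw [hlam, div_lt_one hd]; linarith
    have hl : lam * (u + v - h - h) = k - h := div_mul_cancel₀ _ hd.ne'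
    have m1 : h ∈ Set.Ioo (0 : ℝ) 1 := ⟨h0, by linarith⟩
    have m2 : u + v - h ∈ Set.Ioo (0 : ℝ) 1 := ⟨by linarith, by linarith⟩
    have i1 := hf.2 m1 m2 (by linarith) (sub_pos.2 l1) l0 (by ring)
    have i2 := hf.2 m1 m2 (by linarith) l0 (sub_pos.2 l1) (by ring)
    simp only [smul_eq_mul] at i1 i2
    rw [show (1 - lam) * h + lam * (u + v - h) = k by linarith] at i1
    rw [show lam * h + (1 - lam) * (u + v - h) = u + v - k by linarith] at i2
    linarith
  wlog huv' : u ≤ v generalizing u v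
  · rw [add_comm u v, add_comm (f u)]
    refine this hv hu (by linarith) ?_ (not_le.1 huv').le
    rwa [add_comm v u]
  have h1 := key (u / 2) u (by linarith) (by linarith) (by linarith)
  rw [show u + v - u = v by ring] at h1
  have h2 : f 0 + f (u + v - 0) ≤ f (u / 2) + f (u + v - u / 2) := by
    have ht : Filter.Tendsto (fun h => f h + f (u + v - h)) (nhdsWithin 0 (Set.Ioi 0))
        (nhds (f 0 + f (u + v - 0))) :=
      (Continuous.tendsto (by fun_prop) 0).mono_left nhdsWithin_le_nhds
    refine le_of_tendsto ht ?_
    filter_upwards [Ioo_mem_nhdsGT (show (0 : ℝ) < u / 2 by linarith)] with h hh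
    exact (key h (u / 2) hh.1 hh.2 (by linarith [hh.2])).le
  rw [sub_zero] at h2
  linarith

theorem arcDist_add {L t : ℝ} (s : ℝ) (h0 : 0 ≤ t) (hL : t ≤ L) :
    arcDist L s (s + t) = min t (L - t) := by
  refine IsLeast.csInf_eq ⟨?_, ?_⟩
  · rcases min_choice t (L - t) with h | h <;> rw [h]
    · exact ⟨0, by simp [abs_of_nonneg h0]⟩
    · refine ⟨-1, ?_⟩
      rw [abs_of_nonpos (by push_cast; linarith)]
      push_cast
      ring
  · rintro r ⟨n, rfl⟩
    rcases le_or_gt 0 n with hn | hn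
    · have : (0 : ℝ) ≤ n := by exact_mod_cast hn
      refine (min_le_left _ _).trans (le_trans ?_ (le_abs_self _))
      nlinarith
    · have : (n : ℝ) ≤ -1 := by exact_mod_cast (by omega : n ≤ -1)
      refine (min_le_right _ _).trans (le_trans ?_ (neg_le_abs _))
      nlinarith

theorem arcDist_add_zsmul (L s₁ s₂ : ℝ) (m : ℤ) :
    arcDist L s₁ (s₂ + m • L) = arcDist L s₁ s₂ := by
  unfold arcDist
  congr 1
  ext r
  constructor
  · rintro ⟨n, rfl⟩
    refine ⟨m + n, ?_⟩
    congr 1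
    push_cast [zsmul_eq_mul]
    ring
  · rintro ⟨n, rfl⟩
    refine ⟨n - m, ?_⟩
    congr 1
    push_cast [zsmul_eq_mul]
    ring

section sphere

theorem OrthonormalBasis.inner_eq_fin_three {E : Type*} [NormedAddCommGroup E]
    [InnerProductSpace ℝ E] (b : OrthonormalBasis (Fin 3) ℝ E) (v w : E) :
    ⟪v, w⟫ = ⟪b 0, v⟫ * ⟪b 0, w⟫ + ⟪b 1, v⟫ * ⟪b 1, w⟫ + ⟪b 2, v⟫ * ⟪b 2, w⟫ := by
  rw [← b.sum_inner_mul_inner v w, Fin.sum_univ_three]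
  simp only [real_inner_comm]

theorem OrthonormalBasis.ext_inner_fin_three {E : Type*} [NormedAddCommGroup E]
    [InnerProductSpace ℝ E] (b : OrthonormalBasis (Fin 3) ℝ E) {v w : E}
    (h0 : ⟪b 0, v⟫ = ⟪b 0, w⟫) (h1 : ⟪b 1, v⟫ = ⟪b 1, w⟫) (h2 : ⟪b 2, v⟫ = ⟪b 2, w⟫) : v = w := by
  refine b.repr.injective ?_
  ext i
  fin_cases i <;> simpa [b.repr_apply_apply]

variable {E : Type*} [NormedAddCommGroup E] [InnerProductSpace ℝ E] {γ : ℝ → E} {L : ℝ}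

theorem hasDerivAt_inner_left (hγ : ContDiff ℝ 1 γ) (v : E) (s : ℝ) :
    HasDerivAt (fun s => ⟪v, γ s⟫) ⟪v, deriv γ s⟫ s := by
  have h := (hasDerivAt_const s v).inner ℝ
    (hγ.differentiable one_ne_zero).differentiableAt.hasDerivAt
  simpa using h

theorem eventually_notMem_curve (hL : 0 < L) (hγ : ContDiff ℝ 1 γ) (hper : Function.Periodic γ L)
    (hinj : ∀ s t, s < t → t < s + L → γ t ≠ γ s) (b : OrthonormalBasis (Fin 3) ℝ E) {a : ℝ}
    (ha : γ a = b 0) (hside : ⟪b 2, deriv γ a⟫ ≠ 0) :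
    ∀ᶠ ε in nhdsWithin (0 : ℝ) (Set.Ioi 0), ∀ s, γ s ≠ cos ε • b 0 - sin ε • b 1 := by
  have b02 : ⟪b 2, b 0⟫ = 0 := b.orthonormal.2 (by decide)
  have b12 : ⟪b 2, b 1⟫ = 0 := b.orthonormal.2 (by decide)
  have b01 : ⟪b 1, b 0⟫ = 0 := b.orthonormal.2 (by decide)
  have b11 : ⟪b 1, b 1⟫ = 1 := by simp [b.orthonormal.1 1]
  have h1 := (hasDerivAt_inner_left hγ (b 2) a).eventually_ne hside (c := 0)
  obtain ⟨δ, hδ, hδ'⟩ := Metric.eventually_nhds_iff.1 (eventually_nhdsWithin_iff.1 h1)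
  set K := γ '' Set.Icc (a + δ) (a + L - δ) with hK
  have hKc : IsClosed K := (isCompact_Icc.image hγ.continuous).isClosed
  have h0K : b 0 ∉ K := by
    rintro ⟨s, hs, h⟩
    exact hinj a s (by linarith [hs.1]) (by linarith [hs.2]) (h.trans ha.symm)
  have hcont : Continuous fun ε : ℝ => cos ε • b 0 - sin ε • b 1 := by fun_prop
  have h2 : ∀ᶠ ε in nhds (0 : ℝ), cos ε • b 0 - sin ε • b 1 ∈ Kᶜ :=
    hcont.continuousAt.eventually_mem (hKc.isOpen_compl.mem_nhds (by simpa using h0K))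
  filter_upwards [nhdsWithin_le_nhds h2, Ioo_mem_nhdsGT pi_pos] with ε hε hε' s hs
  have near : ∀ t, |t - a| < δ → γ t ≠ cos ε • b 0 - sin ε • b 1 := by
    intro t ht h
    have ht2 : ⟪b 2, γ t⟫ = 0 := by
      rw [h, inner_sub_right, inner_smul_right, inner_smul_right, b02, b12]; ring
    by_cases hta : t = a
    · have : ⟪b 1, γ t⟫ = - sin ε := by
        rw [h, inner_sub_right, inner_smul_right, inner_smul_right, b01, b11]; ring
      rw [hta, ha, b01] at this
      linarith [sin_pos_of_pos_of_lt_pi hε'.1 hε'.2]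
    · exact hδ' (by rwa [Real.dist_eq]) hta ht2
  obtain ⟨n, hn, -⟩ := existsUnique_add_zsmul_mem_Ico hL s a
  rw [← hper.zsmul n s] at hs
  set t := s + n • L
  rcases lt_or_ge t (a + δ) with h3 | h3
  · exact near t (by rw [abs_lt]; constructor <;> linarith [hn.1]) hs
  rcases le_or_gt t (a + L - δ) with h4 | h4
  · exact hε ⟨t, ⟨h3, h4⟩, hs⟩
  · refine near (t - L) (by rw [abs_lt]; constructor <;> linarith [hn.2]) ?_
    rw [hper.sub_eq, hs]

/-- If a simple closed curve on the sphere passes through the end points of a minimal geodesic in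
directions pointing to the same side of the geodesic, then it meets the interior of the
geodesic. -/
theorem exists_mem_great_arc (hL : 0 < L) (hγ : ContDiff ℝ 1 γ) (hper : Function.Periodic γ L)
    (hunit : ∀ s, ‖deriv γ s‖ = 1) (hsphere : ∀ s, ‖γ s‖ = 1)
    (hinj : ∀ s t, s < t → t < s + L → γ t ≠ γ s) (b : OrthonormalBasis (Fin 3) ℝ E) {a c θ : ℝ}
    (hac : a < c) (hca : c < a + L) (hθ0 : 0 < θ) (hθπ : θ < π)
    (ha : γ a = b 0) (hc : γ c = cos θ • b 0 + sin θ • b 1)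
    (hside : 0 < ⟪b 2, deriv γ a⟫ * ⟪b 2, deriv γ c⟫) :
    ∃ s, (s ∈ Set.Ioo a c ∨ s ∈ Set.Ioo c (a + L)) ∧
      ∃ ψ, 0 < ψ ∧ ψ < θ ∧ γ s = cos ψ • b 0 + sin ψ • b 1 := by
  have hb : ∀ i j, ⟪b i, b j⟫ = if i = j then 1 else 0 := b.inner_eq_ite
  obtain ⟨ε, hε, hε0⟩ := ((eventually_notMem_curve hL hγ hper hinj b ha
    (left_ne_zero_of_mul hside.ne')).and (Ioo_mem_nhdsGT (sub_pos.2 hθπ))).exists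
  have hs2c := sin_sq_add_cos_sq ε
  have hε1 : 0 < ε := hε0.1
  have hε2 : θ + ε < π := by linarith [hε0.2]
  have hd := hasDerivAt_inner_left hγ
  have hcd : ∀ v, ContDiff ℝ 1 fun s => ⟪v, γ s⟫ := fun v => contDiff_const.inner ℝ hγ
  have hsq : ∀ s, ⟪b 0, γ s⟫ ^ 2 + ⟪b 1, γ s⟫ ^ 2 + ⟪b 2, γ s⟫ ^ 2 = 1 := by
    intro s
    have h := b.inner_eq_fin_three (γ s) (γ s)
    rw [real_inner_self_eq_norm_sq, hsphere] at h
    linarith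
  have hdsq : ∀ s, ⟪b 0, deriv γ s⟫ ^ 2 + ⟪b 1, deriv γ s⟫ ^ 2 + ⟪b 2, deriv γ s⟫ ^ 2 = 1 := by
    intro s
    have h := b.inner_eq_fin_three (deriv γ s) (deriv γ s)
    rw [real_inner_self_eq_norm_sq, hunit] at h
    linarith
  set X : ℝ → ℝ := fun s => sin ε * ⟪b 0, γ s⟫ + cos ε * ⟪b 1, γ s⟫ with hX
  set Y : ℝ → ℝ := fun s => ⟪b 2, γ s⟫ with hY
  set W : ℝ → ℝ := fun s => cos ε * ⟪b 0, γ s⟫ - sin ε * ⟪b 1, γ s⟫ with hW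
  have hdX : ∀ s, deriv X s = sin ε * ⟪b 0, deriv γ s⟫ + cos ε * ⟪b 1, deriv γ s⟫ := fun s =>
    (((hd (b 0) s).const_mul _).add ((hd (b 1) s).const_mul _)).deriv
  have hdW : ∀ s, deriv W s = cos ε * ⟪b 0, deriv γ s⟫ - sin ε * ⟪b 1, deriv γ s⟫ := fun s =>
    (((hd (b 0) s).const_mul _).sub ((hd (b 1) s).const_mul _)).deriv
  have hdY : ∀ s, deriv Y s = ⟪b 2, deriv γ s⟫ := fun s => (hd (b 2) s).deriv
  have hu0 : ∀ s, ⟪b 0, γ s⟫ = cos ε * W s + sin ε * X s := fun s => by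
    simp only [hX, hW]; linear_combination -⟪b 0, γ s⟫ * hs2c
  have hu1 : ∀ s, ⟪b 1, γ s⟫ = cos ε * X s - sin ε * W s := fun s => by
    simp only [hX, hW]; linear_combination -⟪b 1, γ s⟫ * hs2c
  have hXYW : ∀ s, X s ^ 2 + Y s ^ 2 + W s ^ 2 = 1 := fun s => by
    simp only [hX, hW, hY]
    linear_combination hsq s + (⟪b 0, γ s⟫ ^ 2 + ⟪b 1, γ s⟫ ^ 2) * hs2c
  have hW1 : ∀ s, W s < 1 := by
    intro s
    refine lt_of_le_of_ne (by nlinarith [hXYW s, sq_nonneg (X s), sq_nonneg (Y s)]) fun h => ?_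
    have hx : X s = 0 := by nlinarith [hXYW s, sq_nonneg (X s), sq_nonneg (Y s)]
    have hy : Y s = 0 := by nlinarith [hXYW s, sq_nonneg (X s), sq_nonneg (Y s)]
    refine hε s (b.ext_inner_fin_three ?_ ?_ ?_)
    · rw [hu0, h, hx]; simp [inner_sub_right, inner_smul_right, hb]
    · rw [hu1, h, hx]; simp [inner_sub_right, inner_smul_right, hb]
    · refine Eq.trans hy ?_
      simp [inner_sub_right, inner_smul_right, hb]
  have hWa : W a = cos ε := by simp [hW, ha, hb]
  have hXa : X a = sin ε := by simp [hX, ha, hb]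
  have hYa : Y a = 0 := by simp [hY, ha, hb]
  have hWc : W c = cos (θ + ε) := by
    simp [hW, hc, hb, inner_add_right, inner_smul_right, cos_add]; ring
  have hXc : X c = sin (θ + ε) := by
    simp [hX, hc, hb, inner_add_right, inner_smul_right, sin_add]; ring
  have hYc : Y c = 0 := by simp [hY, hc, hb, inner_add_right, inner_smul_right]
  obtain ⟨s, hs, hYs, hXs, hWcs, hWsa⟩ := exists_sphere_coord_crossing (X := X) (Y := Y) (W := W) hL
    ((contDiff_const.mul (hcd _)).add (contDiff_const.mul (hcd _)) : ContDiff ℝ 1 X) (hcd _)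
    ((contDiff_const.mul (hcd _)).sub (contDiff_const.mul (hcd _)) : ContDiff ℝ 1 W)
    (fun s => by simp only [hX, hper s]) (fun s => by simp only [hY, hper s])
    (fun s => by simp only [hW, hper s]) hXYW hW1
    (fun s t h1 h2 ⟨ex, ey, ew⟩ => hinj s t h1 h2
      (b.ext_inner_fin_three (by rw [hu0, hu0, ex, ew]) (by rw [hu1, hu1, ex, ew]) ey))
    (fun s ⟨ex, ey, ew⟩ => by
      rw [hdX] at ex
      rw [hdY] at ey
      rw [hdW] at ew
      have := hdsq s
      have h : (0 : ℝ) = 1 := by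
        linear_combination this + (⟪b 0, deriv γ s⟫ ^ 2 + ⟪b 1, deriv γ s⟫ ^ 2) * hs2c -
          ⟪b 2, deriv γ s⟫ * ey -
          (sin ε * ⟪b 0, deriv γ s⟫ + cos ε * ⟪b 1, deriv γ s⟫) * ex -
          (cos ε * ⟪b 0, deriv γ s⟫ - sin ε * ⟪b 1, deriv γ s⟫) * ew
      exact zero_ne_one h)
    hac hca hYa hYc (hXa ▸ sin_pos_of_pos_of_lt_pi hε1 (by linarith))
    (hXc ▸ sin_pos_of_pos_of_lt_pi (by linarith) hε2)
    (by rw [hWa, hWc]; exact cos_lt_cos_of_nonneg_of_le_pi hε1.le hε2.le (by linarith))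
    (by rw [hdY, hdY]; exact hside)
  have hWm : -1 ≤ W s := by rw [hWc] at hWcs; exact (neg_one_le_cos _).trans hWcs.le
  have hcosψ : cos (arccos (W s)) = W s := cos_arccos hWm (hW1 s).le
  have hsinψ : sin (arccos (W s)) = X s := by
    rw [sin_arccos, ← sqrt_sq hXs.le]
    congr 1
    have := hXYW s
    rw [hYs] at this
    linarith
  refine ⟨s, hs, arccos (W s) - ε, ?_, ?_, b.ext_inner_fin_three ?_ ?_ ?_⟩
  · rw [sub_pos, ← arccos_cos hε1.le (by linarith), ← hWa]
    exact arccos_lt_arccos hWm hWsa (hW1 a).le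
  · rw [sub_lt_iff_lt_add, ← arccos_cos (by linarith : 0 ≤ θ + ε) hε2.le, ← hWc]
    exact arccos_lt_arccos (hWc ▸ neg_one_le_cos _) hWcs (hW1 s).le
  · rw [hu0]
    simp [inner_add_right, inner_smul_right, hb, cos_sub, hcosψ, hsinψ]; ring
  · rw [hu1]
    simp [inner_add_right, inner_smul_right, hb, sin_sub, hcosψ, hsinψ]; ring
  · refine Eq.trans hYs ?_
    simp [inner_add_right, inner_smul_right, hb]

end sphere

section configuration

variable {E : Type*} [NormedAddCommGroup E] [InnerProductSpace ℝ E]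

theorem exists_orthonormalBasis_great_arc (hE : Module.finrank ℝ E = 3) {x y : E} {θ : ℝ}
    (hx : ‖x‖ = 1) (hy : ‖y‖ = 1) (hxy : ⟪x, y⟫ = cos θ) (hθ : 0 < sin θ) :
    ∃ b : OrthonormalBasis (Fin 3) ℝ E, b 0 = x ∧ y = cos θ • b 0 + sin θ • b 1 := by
  have : FiniteDimensional ℝ E := .of_finrank_eq_succ hE
  set e : E := (sin θ)⁻¹ • (y - cos θ • x) with he
  have hxx : ⟪x, x⟫ = 1 := by rw [real_inner_self_eq_norm_sq, hx, one_pow]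
  have hyy : ⟪y, y⟫ = 1 := by rw [real_inner_self_eq_norm_sq, hy, one_pow]
  have hxe : ⟪x, e⟫ = 0 := by
    simp [he, inner_smul_right, inner_sub_right, hxy, hx]
  have hee : ⟪e, e⟫ = 1 := by
    simp only [he, inner_smul_left, inner_smul_right, inner_sub_left, inner_sub_right, hxy, hxx,
      hyy, real_inner_comm x y, RCLike.conj_to_real]
    field_simp
    linear_combination -sin_sq_add_cos_sq θ
  obtain ⟨b, hb⟩ := Orthonormal.exists_orthonormalBasis_extension_of_card_eq (𝕜 := ℝ)
    (ι := Fin 3) (by simpa using hE) (v := ![x, e, 0]) (s := {0, 1}) (by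
      have he1 : ‖e‖ = 1 := by
        rw [← pow_eq_one_iff_of_nonneg (norm_nonneg e) two_ne_zero, ← real_inner_self_eq_norm_sq,
          hee]
      constructor
      · rintro ⟨i, rfl | rfl⟩
        · exact hx
        · exact he1
      · rintro ⟨i, rfl | rfl⟩ ⟨j, rfl | rfl⟩ hij
        · exact absurd rfl hij
        · exact hxe
        · exact (real_inner_comm _ _).trans hxe
        · exact absurd rfl hij)
  have h0 : b 0 = x := hb 0 (by simp)
  have h1 : b 1 = e := hb 1 (by simp)
  refine ⟨b, h0, ?_⟩
  rw [h0, h1, he, smul_inv_smul₀ hθ.ne']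
  abel

variable {γ : ℝ → E} {L : ℝ} {φ : ℝ → ℝ}

theorem inner_deriv_right_of_chord_eq (hL : 0 < L) (hγ : ContDiff ℝ 1 γ) (hφ : Differentiable ℝ φ)
    (hle : ∀ p q, p ≤ q → q ≤ p + L → (L * φ ((q - p) / L)) ^ 2 ≤ 2 - 2 * ⟪γ p, γ q⟫) {a c : ℝ}
    (hac : a < c) (hca : c < a + L) (heq : (L * φ ((c - a) / L)) ^ 2 = 2 - 2 * ⟪γ a, γ c⟫) :
    ⟪γ a, deriv γ c⟫ = -(L * φ ((c - a) / L) * deriv φ ((c - a) / L)) := by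
  have h1 : HasDerivAt (fun t => (t - a) / L) (1 / L) c :=
    ((hasDerivAt_id c).sub_const a).div_const L
  have h2 := (((hφ _).hasDerivAt.comp c h1).const_mul L).pow 2
  have h3 := (hasDerivAt_inner_left hγ (γ a) c).add (h2.div_const 2)
  have h4 : IsLocalMax ((fun s => ⟪γ a, γ s⟫) +
      fun s => ((fun t => L * (φ ∘ fun t => (t - a) / L) t) ^ 2) s / 2) c := by
    filter_upwards [Ioo_mem_nhds hac hca] with t ht
    have := hle a t ht.1.le ht.2.le
    simp only [Pi.add_apply, Pi.pow_apply, Function.comp_apply]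
    linarith
  have h5 := h4.hasDerivAt_eq_zero h3
  simp only [Function.comp_apply] at h5
  field_simp at h5
  norm_num at h5
  linarith

theorem inner_deriv_left_of_chord_eq (hL : 0 < L) (hγ : ContDiff ℝ 1 γ) (hφ : Differentiable ℝ φ)
    (hle : ∀ p q, p ≤ q → q ≤ p + L → (L * φ ((q - p) / L)) ^ 2 ≤ 2 - 2 * ⟪γ p, γ q⟫) {a c : ℝ}
    (hac : a < c) (hca : c < a + L) (heq : (L * φ ((c - a) / L)) ^ 2 = 2 - 2 * ⟪γ a, γ c⟫) :
    ⟪γ c, deriv γ a⟫ = L * φ ((c - a) / L) * deriv φ ((c - a) / L) := by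
  have h := inner_deriv_right_of_chord_eq (γ := fun s => γ (-s)) (a := -c) (c := -a) hL
    (hγ.comp contDiff_neg) hφ
    (fun p q hpq hqp => by
      have := hle (-q) (-p) (by linarith) (by linarith)
      rwa [real_inner_comm, show -p - -q = q - p by ring] at this)
    (by linarith) (by linarith)
    (by simpa [real_inner_comm, sub_eq_neg_add, add_comm] using heq)
  rw [deriv_comp_neg] at h
  simpa [sub_eq_neg_add, add_comm] using h

theorem inner_self_deriv_eq_zero (hγ : ContDiff ℝ 1 γ) (hsphere : ∀ s, ‖γ s‖ = 1) (s : ℝ) :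
    ⟪γ s, deriv γ s⟫ = 0 := by
  have hd := (hγ.differentiable one_ne_zero).differentiableAt.hasDerivAt (x := s)
  have h := (hd.inner ℝ hd).unique (by
    simpa only [real_inner_self_eq_norm_sq, hsphere] using hasDerivAt_const s ((1 : ℝ) ^ 2))
  rw [real_inner_comm (γ s) (deriv γ s)] at h
  linarith

theorem deriv_eq_neg_of_antipodal (hsphere : ∀ s, ‖γ s‖ = 1) {a c : ℝ}
    (h : ∀ t, ⟪γ (a + t), γ (c + t)⟫ ≤ -1) : deriv γ c = -deriv γ a := by
  have key : (fun t => γ (c + t)) = fun t => -γ (a + t) := by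
    funext t
    rw [← add_eq_zero_iff_eq_neg, ← norm_eq_zero, ← sq_eq_zero_iff]
    refine le_antisymm ?_ (sq_nonneg _)
    rw [norm_add_sq_real, hsphere, hsphere, real_inner_comm]
    linarith [h t]
  have := congrArg (fun f => deriv f 0) key
  simpa [deriv_comp_const_add, deriv.fun_neg] using this

/-- At a zero minimum of the two-point function, the curve leaves the minimal geodesic joining
the two points to opposite sides. -/
theorem normal_mul_normal_nonpos (hL : 0 < L) (hγ : ContDiff ℝ 1 γ)
    (hper : Function.Periodic γ L) (hunit : ∀ s, ‖deriv γ s‖ = 1) (hsphere : ∀ s, ‖γ s‖ = 1)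
    (hinj : ∀ s t, s < t → t < s + L → γ t ≠ γ s) (hφ : Continuous φ)
    (hφsym : ∀ z ∈ Set.Icc (0 : ℝ) 1, φ (1 - z) = φ z)
    (hφarccos : StrictConcaveOn ℝ (Set.Ioo 0 1)
      (fun z => arccos (1 - L ^ 2 * (φ z) ^ 2 / 2)))
    (hle : ∀ p q, p ≤ q → q ≤ p + L → (L * φ ((q - p) / L)) ^ 2 ≤ 2 - 2 * ⟪γ p, γ q⟫)
    (b : OrthonormalBasis (Fin 3) ℝ E) {a c θ : ℝ} (hac : a < c) (hca : c < a + L) (hθ0 : 0 < θ)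
    (hθπ : θ < π) (heq : (L * φ ((c - a) / L)) ^ 2 = 2 - 2 * cos θ)
    (ha : γ a = b 0) (hc : γ c = cos θ • b 0 + sin θ • b 1) :
    ⟪b 2, deriv γ a⟫ * ⟪b 2, deriv γ c⟫ ≤ 0 := by
  by_contra! hside
  obtain ⟨s, hs, ψ, hψ0, hψθ, hγs⟩ :=
    exists_mem_great_arc hL hγ hper hunit hsphere hinj b hac hca hθ0 hθπ ha hc hside
  have hb : ∀ i j, ⟪b i, b j⟫ = if i = j then 1 else 0 := b.inner_eq_ite
  set Θ : ℝ → ℝ := fun z => arccos (1 - L ^ 2 * (φ z) ^ 2 / 2) with hΘ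
  have hΘc : Continuous Θ := by fun_prop
  have hΘle : ∀ p q α, p ≤ q → q ≤ p + L → 0 ≤ α → α ≤ π → ⟪γ p, γ q⟫ = cos α →
      Θ ((q - p) / L) ≤ α := by
    intro p q α hpq hqp hα0 hαπ hα
    rw [← arccos_cos hα0 hαπ, ← hα]
    exact arccos_le_arccos (by linarith [hle p q hpq hqp, mul_pow L (φ ((q - p) / L)) 2])
  have hΘeq : Θ ((c - a) / L) = θ := by
    rw [← arccos_cos hθ0.le hθπ.le]
    exact congrArg arccos (by linarith [heq, mul_pow L (φ ((c - a) / L)) 2])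
  have has : ⟪γ a, γ s⟫ = cos ψ := by
    simp [hγs, ha, inner_add_right, inner_smul_right, hb]
  have hcs : ⟪γ c, γ s⟫ = cos (θ - ψ) := by
    simp [hγs, hc, inner_add_right, inner_add_left, inner_smul_left, inner_smul_right, hb, cos_sub]
    ring
  have key : ∀ u v, 0 < u → 0 < v → u + v < L → Θ ((u + v) / L) < Θ (u / L) + Θ (v / L) := by
    intro u v hu hv huv
    rw [add_div]
    exact hφarccos.lt_add_of_nonneg hΘc (arccos_nonneg _) (div_pos hu hL) (div_pos hv hL)
      (by rwa [← add_div, div_lt_one hL])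
  rcases hs with hs | hs
  · have h1 := hΘle a s ψ hs.1.le (by linarith [hs.2]) hψ0.le (by linarith) has
    have h2 := hΘle s c (θ - ψ) hs.2.le (by linarith [hs.1]) (by linarith) (by linarith)
      (by rw [real_inner_comm, hcs])
    have h3 := key (s - a) (c - s) (by linarith [hs.1]) (by linarith [hs.2]) (by linarith)
    rw [show s - a + (c - s) = c - a by ring, hΘeq] at h3
    linarith
  · have h1 := hΘle c s (θ - ψ) hs.1.le (by linarith [hs.2]) (by linarith) (by linarith) hcs
    have h2 := hΘle s (a + L) ψ hs.2.le (by linarith [hs.1]) hψ0.le (by linarith)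
      (by rw [hper a, real_inner_comm, has])
    have h3 := key (s - c) (a + L - s) (by linarith [hs.1]) (by linarith [hs.2]) (by linarith)
    have hz : (c - a) / L ∈ Set.Icc (0 : ℝ) 1 :=
      ⟨div_nonneg (by linarith) hL.le, (div_le_one hL).2 (by linarith)⟩
    have h4 : Θ ((s - c + (a + L - s)) / L) = Θ ((c - a) / L) := by
      simp only [hΘ]
      rw [← hφsym _ hz]
      congr
      field_simp
      ring
    rw [h4, hΘeq] at h3
    linarith

theorem inner_deriv_deriv_of_chord_eq (hE : Module.finrank ℝ E = 3) (hL : 0 < L)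
    (hγ : ContDiff ℝ 1 γ)
    (hper : Function.Periodic γ L) (hunit : ∀ s, ‖deriv γ s‖ = 1) (hsphere : ∀ s, ‖γ s‖ = 1)
    (hinj : ∀ s t, s < t → t < s + L → γ t ≠ γ s) (hφ : Differentiable ℝ φ)
    (hφsym : ∀ z ∈ Set.Icc (0 : ℝ) 1, φ (1 - z) = φ z)
    (hφarccos : StrictConcaveOn ℝ (Set.Ioo 0 1)
      (fun z => arccos (1 - L ^ 2 * (φ z) ^ 2 / 2)))
    (hle : ∀ p q, p ≤ q → q ≤ p + L → (L * φ ((q - p) / L)) ^ 2 ≤ 2 - 2 * ⟪γ p, γ q⟫)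
    {a c : ℝ} (hac : a < c) (hca : c < a + L)
    (heq : (L * φ ((c - a) / L)) ^ 2 = 2 - 2 * ⟪γ a, γ c⟫) :
    ⟪deriv γ a, deriv γ c⟫ = 2 * deriv φ ((c - a) / L) ^ 2 - 1 := by
  have hr := inner_deriv_right_of_chord_eq hL hγ hφ hle hac hca heq
  have hl := inner_deriv_left_of_chord_eq hL hγ hφ hle hac hca heq
  have hTa := inner_self_deriv_eq_zero hγ hsphere a
  have hTc := inner_self_deriv_eq_zero hγ hsphere c
  have hlt1 : ⟪γ a, γ c⟫ < 1 :=
    (inner_lt_one_iff_real_of_norm_eq_one (hsphere a) (hsphere c)).2 (hinj a c hac hca).symm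
  set d := L * φ ((c - a) / L) with hd
  set k := deriv φ ((c - a) / L)
  rcases le_or_gt ⟪γ a, γ c⟫ (-1) with hm | hm
  · have hanti : ∀ t, ⟪γ (a + t), γ (c + t)⟫ ≤ -1 := by
      intro t
      have := hle (a + t) (c + t) (by linarith) (by linarith)
      rw [add_sub_add_right_eq_sub, ← hd] at this
      linarith
    have hT := deriv_eq_neg_of_antipodal hsphere hanti
    rw [hT, inner_neg_right, hTa, neg_zero, zero_eq_neg, mul_eq_zero] at hr
    have hk : k = 0 := hr.resolve_left fun h => by rw [h] at heq; linarith
    rw [hT, inner_neg_right, real_inner_self_eq_norm_sq, hunit, hk]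
    norm_num
  · have hcos : ⟪γ a, γ c⟫ = cos (arccos ⟪γ a, γ c⟫) := (cos_arccos hm.le hlt1.le).symm
    have hθ0 : 0 < arccos ⟪γ a, γ c⟫ := arccos_pos.2 hlt1
    have hθπ : arccos ⟪γ a, γ c⟫ < π :=
      lt_of_le_of_ne (arccos_le_pi _) fun h => by linarith [arccos_eq_pi.1 h]
    set θ := arccos ⟪γ a, γ c⟫
    have hsin := sin_pos_of_pos_of_lt_pi hθ0 hθπ
    obtain ⟨b, hb0, hbc⟩ :=
      exists_orthonormalBasis_great_arc hE (hsphere a) (hsphere c) hcos hsin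
    rw [hcos] at heq
    have hqw := normal_mul_normal_nonpos hL hγ hper hunit hsphere hinj hφ.continuous hφsym hφarccos
      hle b hac hca hθ0 hθπ heq hb0.symm hbc
    have hna := b.inner_eq_fin_three (deriv γ a) (deriv γ a)
    have hnc := b.inner_eq_fin_three (deriv γ c) (deriv γ c)
    rw [real_inner_self_eq_norm_sq, hunit] at hna hnc
    rw [b.inner_eq_fin_three]
    rw [hbc, inner_add_left, real_inner_smul_left, real_inner_smul_left] at hl hTc
    rw [← hb0] at hr hTa
    rw [hTa] at hl hna ⊢
    rw [hr] at hTc hnc ⊢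
    generalize ⟪b 1, deriv γ a⟫ = p at *
    generalize ⟪b 1, deriv γ c⟫ = v at *
    generalize ⟪b 2, deriv γ a⟫ = q at *
    generalize ⟪b 2, deriv γ c⟫ = w at *
    have hs2 := sin_sq_add_cos_sq θ
    have hdk : d * k = sin θ * p := by linarith
    have hv : v = p * cos θ := mul_left_cancel₀ hsin.ne' (by
      linear_combination hTc + cos θ * hdk)
    have hqw2 : (q * w) ^ 2 = (q ^ 2) ^ 2 := by
      rw [hdk, hv] at hnc
      linear_combination q ^ 2 * (hna - hnc - p ^ 2 * hs2)
    have hqw' : q * w = -q ^ 2 :=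
      (sq_eq_sq_iff_eq_or_eq_neg.1 hqw2).elim (fun h => by nlinarith [sq_nonneg q]) id
    have hk : p ^ 2 * (1 + cos θ) = 2 * k ^ 2 := by
      have h1 : 1 - cos θ ≠ 0 := by linarith [hlt1, hcos]
      refine mul_left_cancel₀ h1 ?_
      linear_combination -p ^ 2 * hs2 - (d * k + sin θ * p) * hdk + k ^ 2 * heq
    rw [hv, hqw']
    linear_combination hk + hna

end configuration

/-- Lemma on the relative configuration of tangents at a zero minimum of the chord-arc
difference `Z(s₁,s₂) = |γ(s₁) − γ(s₂)| − Lφ(ℓ(s₁,s₂)/L)` for a simple closed spherical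
curve `γ` and a barrier `φ` satisfying the key properties: if `Z ≥ 0` everywhere and
`Z(s₁,s₂) = 0` with `γ(s₁) ≠ γ(s₂)`, then `⟨T(s₁), T(s₂)⟩ = 2φ'(ℓ/L)² − 1`. -/
theorem critical_configuration (L : ℝ) (hL : 0 < L)
    (γ : ℝ → EuclideanSpace ℝ (Fin 3))
    (hsmooth : ContDiff ℝ (⊤ : ℕ∞) γ)
    (hper : Function.Periodic γ L)
    (hunit : ∀ s, ‖deriv γ s‖ = 1)
    (hsphere : ∀ s, ‖γ s‖ = 1)
    (hinj : Set.InjOn γ (Set.Ico 0 L))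
    (φ : ℝ → ℝ) (hφsmooth : ContDiff ℝ (⊤ : ℕ∞) φ)
    (hφ0 : φ 0 = 0) (hφ1 : φ 1 = 0)
    (hφnonneg : ∀ z ∈ Set.Icc (0 : ℝ) 1, 0 ≤ φ z)
    (hφsym : ∀ z ∈ Set.Icc (0 : ℝ) 1, φ (1 - z) = φ z)
    (hφderiv : ∀ z ∈ Set.Icc (0 : ℝ) 1, |deriv φ z| ≤ 1)
    (hφconc : StrictConcaveOn ℝ (Set.Icc 0 1) φ)
    (hφsmall : ∀ z ∈ Set.Icc (0 : ℝ) 1, L * φ z ≤ 2)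
    (hφarccos : StrictConcaveOn ℝ (Set.Ioo 0 1)
      (fun z => Real.arccos (1 - L ^ 2 * (φ z) ^ 2 / 2)))
    (Z : ℝ → ℝ → ℝ)
    (hZ : ∀ s₁ s₂, Z s₁ s₂ = ‖γ s₁ - γ s₂‖ - L * φ (arcDist L s₁ s₂ / L))
    (hZnonneg : ∀ s₁ s₂, 0 ≤ Z s₁ s₂)
    (s₁ s₂ : ℝ) (hzero : Z s₁ s₂ = 0) (hne : γ s₁ ≠ γ s₂) :
    ⟪deriv γ s₁, deriv γ s₂⟫ = 2 * (deriv φ (arcDist L s₁ s₂ / L)) ^ 2 - 1 := by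
  have hγ : ContDiff ℝ 1 γ := hsmooth.of_le (by simp)
  have hφd : Differentiable ℝ φ := hφsmooth.differentiable (by simp)
  have hinj' : ∀ s t, s < t → t < s + L → γ t ≠ γ s := by
    intro s t hst hts h
    obtain ⟨n, hn, -⟩ := existsUnique_add_zsmul_mem_Ico hL s 0
    obtain ⟨m, hm, -⟩ := existsUnique_add_zsmul_mem_Ico hL t 0
    rw [zero_add] at hn hm
    have h1 := hinj hm hn (by rw [hper.zsmul, hper.zsmul, h])
    simp only [zsmul_eq_mul] at h1
    have h2 : t - s = ((n - m : ℤ) : ℝ) * L := by push_cast; linarith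
    have h3 : (0 : ℝ) < (n - m : ℤ) := pos_of_mul_pos_left (by linarith) hL.le
    have h4 : ((n - m : ℤ) : ℝ) < 1 := by nlinarith
    have h5 : 0 < n - m := by exact_mod_cast h3
    have h6 : n - m < 1 := by exact_mod_cast h4
    omega
  have hφmin : ∀ s t, 0 ≤ t → t ≤ L → φ (arcDist L s (s + t) / L) = φ (t / L) := by
    intro s t h0 h1
    rw [arcDist_add s h0 h1]
    rcases min_choice t (L - t) with h | h <;> rw [h]
    rw [sub_div, div_self hL.ne']
    exact hφsym _ ⟨by positivity, (div_le_one hL).2 h1⟩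
  have hnormsq : ∀ p q, ‖γ p - γ q‖ ^ 2 = 2 - 2 * ⟪γ p, γ q⟫ := by
    intro p q
    rw [norm_sub_sq_real, hsphere, hsphere]
    ring
  have hle : ∀ p q, p ≤ q → q ≤ p + L →
      (L * φ ((q - p) / L)) ^ 2 ≤ 2 - 2 * ⟪γ p, γ q⟫ := by
    intro p q hpq hqp
    rw [← hnormsq]
    have h1 := hZnonneg p q
    have h2 := hφmin p (q - p) (by linarith) (by linarith)
    rw [add_sub_cancel] at h2
    rw [hZ, h2] at h1
    have h3 := hφnonneg ((q - p) / L)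
      ⟨div_nonneg (by linarith) hL.le, (div_le_one hL).2 (by linarith)⟩
    exact pow_le_pow_left₀ (by positivity) (by linarith) 2
  obtain ⟨n, hn, -⟩ := existsUnique_add_zsmul_mem_Ico hL s₂ s₁
  have hγc : γ (s₂ + n • L) = γ s₂ := hper.zsmul n s₂
  have hTc : deriv γ (s₂ + n • L) = deriv γ s₂ := by
    rw [← deriv_comp_add_const]
    congr 1
    exact funext (hper.zsmul n)
  rw [hZ, ← hγc, ← arcDist_add_zsmul L s₁ s₂ n] at hzero
  rw [← hTc, ← arcDist_add_zsmul L s₁ s₂ n]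
  rw [← hγc] at hne
  generalize s₂ + n • L = c at *
  have hac : s₁ < c := lt_of_le_of_ne hn.1 fun h => hne (congrArg γ h)
  have h1 := hφmin s₁ (c - s₁) (by linarith) (by linarith [hn.2])
  rw [add_sub_cancel] at h1
  rw [h1, sub_eq_zero] at hzero
  rw [inner_deriv_deriv_of_chord_eq finrank_euclideanSpace_fin hL hγ hper hunit hsphere hinj' hφd
    hφsym hφarccos hle hac hn.2 (by rw [← hzero, hnormsq])]
  congr 2
  have h2 := arcDist_add (L := L) s₁ (t := c - s₁) (by linarith) (by linarith [hn.2])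
  rw [add_sub_cancel] at h2
  rw [h2]
  rcases min_choice (c - s₁) (L - (c - s₁)) with h | h <;> rw [h]
  have hz : (c - s₁) / L ∈ Set.Ioo (0 : ℝ) 1 :=
    ⟨div_pos (by linarith) hL, (div_lt_one hL).2 (by linarith [hn.2])⟩
  have h3 : (fun z => φ (1 - z)) =ᶠ[nhds ((c - s₁) / L)] φ := by
    filter_upwards [Ioo_mem_nhds hz.1 hz.2] with z hz
    exact hφsym z ⟨hz.1.le, hz.2.le⟩
  rw [sub_div L, div_self hL.ne', ← h3.deriv_eq, deriv_comp_const_sub, neg_sq]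
end

section
/- Fix a₀ > 0 and define a(τ) := a₀ e^{−4π²τ} and φ(z, τ) := a(τ)⁻¹ arctan((a(τ)/π) sin(π z)). Then for all z ∈ (0,1) and all τ ≥ 0, φ satisfies the partial differential equation ∂_τ φ = 4(∂_z² φ + π² φ) + (8π / tan(π z)) ∂_z φ − (8π / sin(π z)) (∂_z φ)². -/
open Real

/-- The spatial derivative of `b⁻¹ arctan((b/π) sin(πz))` is `cos(πz) / (1 + ((b/π) sin(πz))²)`. -/
theorem hasDerivAt_inv_mul_arctan_sin {b : ℝ} (hb : b ≠ 0) (z : ℝ) :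
    HasDerivAt (fun y => b⁻¹ * Real.arctan (b / π * Real.sin (π * y)))
      (Real.cos (π * z) / (1 + (b / π * Real.sin (π * z)) ^ 2)) z := by
  have hlin : HasDerivAt (fun y : ℝ => π * y) π z := by
    simpa using (hasDerivAt_id z).const_mul π
  refine ((hlin.sin.const_mul (b / π)).arctan.const_mul b⁻¹).congr_deriv ?_
  have hD : 1 + (b / π * Real.sin (π * z)) ^ 2 ≠ 0 := by positivity
  have hπ := Real.pi_ne_zero
  generalize 1 + (b / π * Real.sin (π * z)) ^ 2 = D at hD ⊢
  field_simp

/-- The derivative of `cos(πz) / (1 + ((b/π) sin(πz))²)`. -/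
theorem hasDerivAt_cos_div_one_add_sin_sq (b z : ℝ) :
    HasDerivAt (fun y => Real.cos (π * y) / (1 + (b / π * Real.sin (π * y)) ^ 2))
      (-(π * Real.sin (π * z)) / (1 + (b / π * Real.sin (π * z)) ^ 2)
        - 2 * b ^ 2 * Real.sin (π * z) * Real.cos (π * z) ^ 2
          / (π * (1 + (b / π * Real.sin (π * z)) ^ 2) ^ 2)) z := by
  have hlin : HasDerivAt (fun y : ℝ => π * y) π z := by
    simpa using (hasDerivAt_id z).const_mul π
  have hD : 1 + (b / π * Real.sin (π * z)) ^ 2 ≠ 0 := by positivity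
  refine (hlin.cos.fun_div (((hlin.sin.const_mul (b / π)).fun_pow 2).const_add 1) hD).congr_deriv ?_
  have hπ := Real.pi_ne_zero
  generalize 1 + (b / π * Real.sin (π * z)) ^ 2 = D at hD ⊢
  push_cast
  field_simp

/-- If `a' = -4π² a` at `τ`, this is the time derivative of `a⁻¹ arctan((a/π) s)`. -/
theorem hasDerivAt_inv_mul_arctan_of_decay {a : ℝ → ℝ} {τ : ℝ} (ha : a τ ≠ 0)
    (hda : HasDerivAt a (-4 * π ^ 2 * a τ) τ) (s : ℝ) :
    HasDerivAt (fun t => (a t)⁻¹ * Real.arctan (a t / π * s))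
      (4 * π ^ 2 * ((a τ)⁻¹ * Real.arctan (a τ / π * s))
        - 4 * π * s / (1 + (a τ / π * s) ^ 2)) τ := by
  refine ((hda.fun_inv ha).fun_mul ((hda.div_const π).mul_const s).arctan).congr_deriv ?_
  have hD : 1 + (a τ / π * s) ^ 2 ≠ 0 := by positivity
  have hπ := Real.pi_ne_zero
  generalize Real.arctan (a τ / π * s) = A
  generalize 1 + (a τ / π * s) ^ 2 = D at hD ⊢
  field_simp
  ring

/-- The time-dependent comparison function `φ(z,τ) = a(τ)⁻¹ arctan((a(τ)/π) sin(πz))`,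
with `a(τ) = a₀ e^{−4π²τ}`, satisfies the evolution equation
`∂_τ φ = 4(∂_z²φ + π²φ) + (8π/tan(πz)) ∂_z φ − (8π/sin(πz)) (∂_z φ)²`
for all `z ∈ (0,1)` and `τ ≥ 0`. -/
theorem phi_evolution (a₀ : ℝ) (ha₀ : 0 < a₀)
    (a : ℝ → ℝ) (ha : ∀ τ, a τ = a₀ * Real.exp (-4 * π ^ 2 * τ))
    (φ : ℝ → ℝ → ℝ)
    (hφ : ∀ τ z, φ τ z = (a τ)⁻¹ * Real.arctan (a τ / π * Real.sin (π * z)))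
    (z : ℝ) (hz : z ∈ Set.Ioo (0 : ℝ) 1) (τ : ℝ) (hτ : 0 ≤ τ) :
    deriv (fun t => φ t z) τ
      = 4 * (deriv (deriv (φ τ)) z + π ^ 2 * φ τ z)
        + 8 * π / Real.tan (π * z) * deriv (φ τ) z
        - 8 * π / Real.sin (π * z) * (deriv (φ τ) z) ^ 2 := by
  have hane : a τ ≠ 0 := by rw [ha]; positivity
  have hda : HasDerivAt a (-4 * π ^ 2 * a τ) τ := by
    rw [funext ha]
    have hlin : HasDerivAt (fun t : ℝ => -4 * π ^ 2 * t) (-4 * π ^ 2) τ := by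
      simpa only [id, mul_one] using (hasDerivAt_id τ).const_mul (-4 * π ^ 2)
    refine (hlin.exp.const_mul a₀).congr_deriv ?_
    ring
  have hs : Real.sin (π * z) ≠ 0 :=
    (Real.sin_pos_of_pos_of_lt_pi (mul_pos Real.pi_pos hz.1)
      (mul_lt_of_lt_one_right Real.pi_pos hz.2)).ne'
  have hdz : deriv (φ τ) =
      fun y => Real.cos (π * y) / (1 + (a τ / π * Real.sin (π * y)) ^ 2) := by
    rw [funext (hφ τ)]
    exact funext fun y => (hasDerivAt_inv_mul_arctan_sin hane y).deriv
  have hdt := (hasDerivAt_inv_mul_arctan_of_decay hane hda (Real.sin (π * z))).deriv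
  simp only [hdz, (hasDerivAt_cos_div_one_add_sin_sq (a τ) z).deriv, hφ, hdt,
    Real.tan_eq_sin_div_cos, div_div_eq_mul_div]
  have hD : 1 + (a τ / π * Real.sin (π * z)) ^ 2 ≠ 0 := by positivity
  have hπ := Real.pi_ne_zero
  generalize Real.arctan (a τ / π * Real.sin (π * z)) = A
  generalize hDe : 1 + (a τ / π * Real.sin (π * z)) ^ 2 = D at hD ⊢
  have hDπ : π ^ 2 * (D - 1) = a τ ^ 2 * Real.sin (π * z) ^ 2 := by
    rw [← hDe]
    field_simp
    ring
  field_simp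
  linear_combination (-8 * Real.cos (π * z) ^ 2 * a τ) * hDπ
end

section
/- Let {Γ_t}, t ∈ [0,T), be a curve shortening flow of simple closed curves on the unit sphere S² ⊂ ℝ³, with total length L(t). Then L is differentiable and satisfies L'(t) ≤ L(t) − 4π²/L(t) for all t, with strict inequality unless the geodesic curvature of Γ_t is constant. -/
open Real MeasureTheory

noncomputable section

/-- Arclength derivative `∂_s f = |∂_u γ|⁻¹ ∂_u f` along the family of curves `u ↦ γ u t`. -/
def pS (γ f : ℝ → ℝ → EuclideanSpace ℝ (Fin 3)) (u t : ℝ) : EuclideanSpace ℝ (Fin 3) :=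
  ‖deriv (fun v => γ v t) u‖⁻¹ • deriv (fun v => f v t) u

/-- The geodesic curvature vector `∂_s²γ + γ` of the spherical curve `u ↦ γ u t`. -/
def curvVec (γ : ℝ → ℝ → EuclideanSpace ℝ (Fin 3)) (u t : ℝ) : EuclideanSpace ℝ (Fin 3) :=
  pS γ (pS γ γ) u t + γ u t

/-- A curve shortening flow `∂_t γ = ∂_s²γ + γ` of simple closed curves on the unit sphere
`S² ⊂ ℝ³`, defined for times `t` in the set `D` (each `γ(·,t)` is a `2π`-periodic regular
parametrisation, injective on a period, of a simple closed spherical curve `Γ_t`). -/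
structure SphereCSF (D : Set ℝ) where
  γ : ℝ → ℝ → EuclideanSpace ℝ (Fin 3)
  smooth : ContDiffOn ℝ (⊤ : ℕ∞) (fun p : ℝ × ℝ => γ p.1 p.2) (Set.univ ×ˢ D)
  spherical : ∀ t ∈ D, ∀ u, ‖γ u t‖ = 1
  periodic : ∀ t ∈ D, Function.Periodic (fun u => γ u t) (2 * π)
  regular : ∀ t ∈ D, ∀ u, deriv (fun v => γ v t) u ≠ 0
  simple : ∀ t ∈ D, Set.InjOn (fun u => γ u t) (Set.Ico 0 (2 * π))
  flow : ∀ t ∈ D, ∀ u, HasDerivWithinAt (fun s => γ u s) (curvVec γ u t) D t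

variable {D : Set ℝ}

/-- The parametrisation speed `|∂_u γ|`. -/
def SphereCSF.speed (F : SphereCSF D) (u t : ℝ) : ℝ := ‖deriv (fun v => F.γ v t) u‖

/-- The total length `L(t)` of the curve `Γ_t`. -/
def SphereCSF.length (F : SphereCSF D) (t : ℝ) : ℝ := ∫ u in (0:ℝ)..(2 * π), F.speed u t

/-- The length `ℓ` of the shorter of the two arcs of `Γ_t` joining `γ(u,t)` to `γ(v,t)`. -/
def SphereCSF.arcLen (F : SphereCSF D) (t u v : ℝ) : ℝ :=
  min |∫ w in u..v, F.speed w t| (F.length t - |∫ w in u..v, F.speed w t|)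

/-- The Euclidean chord length `d` between `γ(u,t)` and `γ(v,t)`. -/
def SphereCSF.chord (F : SphereCSF D) (t u v : ℝ) : ℝ := ‖F.γ u t - F.γ v t‖

/-- The squared geodesic curvature `κ² = |∂_s²γ + γ|²`. -/
def SphereCSF.curvSq (F : SphereCSF D) (u t : ℝ) : ℝ := ‖curvVec F.γ u t‖ ^ 2

/-- The rescaled time `τ(t) = ∫₀ᵗ L(s)⁻² ds`. -/
def SphereCSF.tau (F : SphereCSF D) (t : ℝ) : ℝ := ∫ s in (0:ℝ)..t, ((F.length s) ^ 2)⁻¹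

open scoped Topology ContDiff

section General

variable {E : Type*} [NormedAddCommGroup E] [InnerProductSpace ℝ E]

theorem inner_deriv_eq_zero_of_norm_eq_one_s13 {c : ℝ → E} (hc : Differentiable ℝ c)
    (h1 : ∀ u, ‖c u‖ = 1) (u : ℝ) : inner ℝ (c u) (deriv c u) = 0 := by
  have h := (hc u).hasDerivAt.inner ℝ (hc u).hasDerivAt
  have hconst : (fun x => inner ℝ (c x) (c x)) = fun _ => (1 : ℝ) := by
    funext x
    rw [real_inner_self_eq_norm_sq, h1, one_pow]
  rw [hconst] at h
  have h2 := h.unique (hasDerivAt_const u (1 : ℝ))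
  rw [real_inner_comm (c u) (deriv c u)] at h2
  linarith

theorem sq_inner_le_of_inner_eq_zero {p x y : E} (hp : ‖p‖ = 1) (hx : ‖x‖ = 1)
    (hxy : inner ℝ x y = 0) :
    (inner ℝ p y) ^ 2 ≤ ‖y‖ ^ 2 * (1 - (inner ℝ p x) ^ 2) := by
  have h1 : inner ℝ (p - (inner ℝ p x : ℝ) • x) y = inner ℝ p y := by
    rw [inner_sub_left, inner_smul_left, hxy]; simp
  have h2 : ‖p - (inner ℝ p x : ℝ) • x‖ ^ 2 = 1 - (inner ℝ p x) ^ 2 := by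
    rw [norm_sub_sq_real, inner_smul_right, norm_smul, hp, hx, mul_one, Real.norm_eq_abs, sq_abs]
    ring
  have h3 := abs_real_inner_le_norm (p - (inner ℝ p x : ℝ) • x) y
  rw [h1] at h3
  calc (inner ℝ p y) ^ 2 = |inner ℝ p y| ^ 2 := (sq_abs _).symm
    _ ≤ (‖p - (inner ℝ p x : ℝ) • x‖ * ‖y‖) ^ 2 := by gcongr
    _ = _ := by rw [mul_pow, h2]; ring

/-- The angle between two points of a curve on the unit sphere is at most the length of the arc
joining them. -/
theorem arccos_inner_le_integral_norm_deriv {τ : ℝ → E} (hτ : ContDiff ℝ 1 τ)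
    (h1 : ∀ u, ‖τ u‖ = 1) {a b : ℝ} (hab : a ≤ b) :
    arccos (inner ℝ (τ a) (τ b)) ≤ ∫ u in a..b, ‖deriv τ u‖ := by
  have hd : Differentiable ℝ τ := hτ.differentiable one_ne_zero
  have hcont : Continuous fun u => ‖deriv τ u‖ := (hτ.continuous_deriv le_rfl).norm
  have hrad : ∀ r ∈ Set.Ioo (0 : ℝ) 1, arccos (r * inner ℝ (τ a) (τ b)) ≤
      arccos (r * inner ℝ (τ a) (τ a)) + ∫ u in a..b, ‖deriv τ u‖ := by
    intro r hr
    have hder : ∀ u, HasDerivAt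
        (fun u => (∫ x in a..u, ‖deriv τ x‖) - arccos (r * inner ℝ (τ a) (τ u)))
        (‖deriv τ u‖ - -(1 / √(1 - (r * inner ℝ (τ a) (τ u)) ^ 2)) *
          (r * inner ℝ (τ a) (deriv τ u))) u ∧
        0 ≤ ‖deriv τ u‖ - -(1 / √(1 - (r * inner ℝ (τ a) (τ u)) ^ 2)) *
          (r * inner ℝ (τ a) (deriv τ u)) := by
      intro u
      have hsq := sq_inner_le_of_inner_eq_zero (h1 a) (h1 u)
        (inner_deriv_eq_zero_of_norm_eq_one_s13 hd h1 u)
      have hin : |inner ℝ (τ a) (τ u)| ≤ 1 := by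
        simpa [h1] using abs_real_inner_le_norm (τ a) (τ u)
      set f := inner ℝ (τ a) (τ u) with hf
      set g := inner ℝ (τ a) (deriv τ u) with hg
      have hf2 : f ^ 2 ≤ 1 := (sq_le_one_iff_abs_le_one f).2 hin
      have hr2 : r ^ 2 < 1 := by nlinarith [hr.1, hr.2]
      have hpos : 0 < 1 - (r * f) ^ 2 := by nlinarith [sq_nonneg r, sq_nonneg f]
      have hinner : HasDerivAt (fun u => r * inner ℝ (τ a) (τ u)) (r * g) u := by
        have := ((hasDerivAt_const u (τ a)).inner ℝ (hd u).hasDerivAt).const_mul r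
        simpa [hg] using this
      refine ⟨?_, ?_⟩
      · have hac : HasDerivAt arccos (-(1 / √(1 - (r * f) ^ 2))) (r * f) := by
          apply hasDerivAt_arccos
          · intro h; rw [h] at hpos; norm_num at hpos
          · intro h; rw [h] at hpos; norm_num at hpos
        exact (hcont.integral_hasStrictDerivAt a u).hasDerivAt.sub
          (HasDerivAt.comp u (h₂ := arccos) hac hinner)
      · have hs : 0 < √(1 - (r * f) ^ 2) := sqrt_pos.2 hpos
        have hbound : |r * g| ≤ ‖deriv τ u‖ * √(1 - (r * f) ^ 2) := by
          apply abs_le_of_sq_le_sq _ (by positivity)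
          rw [mul_pow, mul_pow, sq_sqrt hpos.le]
          have : r ^ 2 * (1 - f ^ 2) ≤ 1 - (r * f) ^ 2 := by nlinarith
          calc r ^ 2 * g ^ 2 ≤ r ^ 2 * (‖deriv τ u‖ ^ 2 * (1 - f ^ 2)) := by gcongr
            _ = ‖deriv τ u‖ ^ 2 * (r ^ 2 * (1 - f ^ 2)) := by ring
            _ ≤ _ := by gcongr
        have h3 : -(r * g) / √(1 - (r * f) ^ 2) ≤ ‖deriv τ u‖ := by
          rw [div_le_iff₀ hs]
          linarith [neg_abs_le (r * g)]
        have h4 : -(1 / √(1 - (r * f) ^ 2)) * (r * g) = -(r * g) / √(1 - (r * f) ^ 2) := by ring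
        rw [h4]; linarith
    have hmono := monotone_of_hasDerivAt_nonneg (fun u => (hder u).1) (fun u => (hder u).2) hab
    simp only [intervalIntegral.integral_same] at hmono
    linarith
  have hl : Filter.Tendsto (fun r : ℝ => arccos (r * inner ℝ (τ a) (τ b))) (𝓝[<] 1)
      (𝓝 (arccos (1 * inner ℝ (τ a) (τ b)))) :=
    ((by fun_prop : Continuous fun r : ℝ => arccos (r * inner ℝ (τ a) (τ b))).tendsto 1).mono_left
      nhdsWithin_le_nhds
  have hr : Filter.Tendsto (fun r : ℝ => arccos (r * inner ℝ (τ a) (τ a)) +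
      ∫ u in a..b, ‖deriv τ u‖) (𝓝[<] 1)
      (𝓝 (arccos (1 * inner ℝ (τ a) (τ a)) + ∫ u in a..b, ‖deriv τ u‖)) :=
    ((by fun_prop : Continuous fun r : ℝ => arccos (r * inner ℝ (τ a) (τ a)) +
      ∫ u in a..b, ‖deriv τ u‖).tendsto 1).mono_left nhdsWithin_le_nhds
  have := le_of_tendsto_of_tendsto hl hr
    (Filter.eventually_of_mem (Ioo_mem_nhdsLT zero_lt_one) hrad)
  simpa [real_inner_self_eq_norm_sq, h1] using this

theorem add_pos_of_arccos_add_arccos_lt_pi {x y : ℝ} (h : arccos x + arccos y < π) :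
    0 < x + y := by
  by_contra hxy
  have h1 : arccos (-y) ≤ arccos x := arccos_le_arccos (by linarith)
  rw [arccos_neg] at h1
  linarith

/-- **Fenchel's theorem**, for a tangent indicatrix `τ` with speed `v`. -/
theorem two_pi_le_integral_norm_deriv [CompleteSpace E] {τ : ℝ → E} {v : ℝ → ℝ} {a b : ℝ}
    (hab : a < b)
    (hτ : ContDiff ℝ 1 τ) (h1 : ∀ u, ‖τ u‖ = 1) (hv : Continuous v) (hv0 : ∀ u, 0 < v u)
    (hclosed : τ a = τ b) (hmean : ∫ u in a..b, v u • τ u = 0) :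
    2 * π ≤ ∫ u in a..b, ‖deriv τ u‖ := by
  by_contra! hlt
  have hcont : Continuous fun u => ‖deriv τ u‖ := (hτ.continuous_deriv le_rfl).norm
  have hint : ∀ x y, IntervalIntegrable (fun u => ‖deriv τ u‖) volume x y :=
    fun x y => hcont.intervalIntegrable x y
  set Λ := ∫ u in a..b, ‖deriv τ u‖ with hΛ
  have hΛ0 : 0 ≤ Λ := intervalIntegral.integral_nonneg hab.le fun u _ => norm_nonneg _
  obtain ⟨m, hm, hmΛ⟩ : ∃ m ∈ Set.Icc a b, ∫ u in a..m, ‖deriv τ u‖ = Λ / 2 := by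
    have hc : ContinuousOn (fun x => ∫ u in a..x, ‖deriv τ u‖) (Set.Icc a b) :=
      (intervalIntegral.continuous_primitive hint a).continuousOn
    have := intermediate_value_Icc hab.le hc
    apply this
    simp only [intervalIntegral.integral_same]
    exact ⟨by linarith, by rw [← hΛ]; linarith⟩
  have hmΛ' : ∫ u in m..b, ‖deriv τ u‖ = Λ / 2 := by
    have := intervalIntegral.integral_add_adjacent_intervals (hint a m) (hint m b)
    linarith
  have hpos : ∀ u ∈ Set.Icc a b, 0 < inner ℝ (τ a + τ m) (τ u) := by
    intro u hu
    rw [inner_add_left]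
    apply add_pos_of_arccos_add_arccos_lt_pi
    rcases le_total u m with hum | hum
    · have e1 := arccos_inner_le_integral_norm_deriv hτ h1 hu.1
      have e2 := arccos_inner_le_integral_norm_deriv hτ h1 hum
      have e3 := intervalIntegral.integral_add_adjacent_intervals (hint a u) (hint u m)
      rw [real_inner_comm (τ u) (τ m)]
      linarith
    · have e1 := arccos_inner_le_integral_norm_deriv hτ h1 hu.2
      have e2 := arccos_inner_le_integral_norm_deriv hτ h1 hum
      have e3 := intervalIntegral.integral_add_adjacent_intervals (hint m u) (hint u b)
      rw [hclosed, real_inner_comm]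
      linarith
  have hcτ : Continuous τ := hτ.continuous
  have hI : 0 < ∫ u in a..b, inner ℝ (τ a + τ m) (v u • τ u) := by
    apply intervalIntegral.intervalIntegral_pos_of_pos_on
    · exact (by fun_prop : Continuous fun u => inner ℝ (τ a + τ m) (v u • τ u)).intervalIntegrable
        a b
    · intro u hu
      rw [inner_smul_right]
      exact mul_pos (hv0 u) (hpos u (Set.Ioo_subset_Icc_self hu))
    · exact hab
  have hI' : ∫ u in a..b, inner ℝ (τ a + τ m) (v u • τ u) =
      inner ℝ (τ a + τ m) (∫ u in a..b, v u • τ u) :=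
    ((innerSL ℝ (τ a + τ m)).intervalIntegral_comp_comm
      ((by fun_prop : Continuous fun u => v u • τ u).intervalIntegrable a b))
  rw [hI', hmean, inner_zero_right] at hI
  exact lt_irrefl _ hI

/-- Cauchy–Schwarz for `∫ h` with weight `v`, with its equality case, when `∫ h ≥ A`. -/
theorem sq_div_integral_le_integral_sq_div {v h : ℝ → ℝ} {a b A : ℝ} (hab : a < b)
    (hA : 0 ≤ A) (hv : Continuous v) (hv0 : ∀ u, 0 < v u) (hh : Continuous h)
    (hAh : A ≤ ∫ u in a..b, h u) :
    A ^ 2 / (∫ u in a..b, v u) ≤ ∫ u in a..b, h u ^ 2 / v u ∧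
      ((∫ u in a..b, h u ^ 2 / v u) = A ^ 2 / (∫ u in a..b, v u) →
        ∃ k : ℝ, ∀ u ∈ Set.Icc a b, h u = k * v u) := by
  set L := ∫ u in a..b, v u with hL
  have hL0 : 0 < L :=
    intervalIntegral.intervalIntegral_pos_of_pos_on (hv.intervalIntegrable a b)
      (fun u _ => hv0 u) hab
  set k := A / L with hk
  have hk0 : 0 ≤ k := by positivity
  have hdiv : Continuous fun u => h u ^ 2 / v u := (hh.pow 2).div hv fun u => (hv0 u).ne'
  have hdiv' : Continuous fun u => (h u - k * v u) ^ 2 / v u :=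
    ((hh.sub (hv.const_mul k)).pow 2).div hv fun u => (hv0 u).ne'
  have hexp : ∫ u in a..b, (h u - k * v u) ^ 2 / v u =
      (∫ u in a..b, h u ^ 2 / v u) - 2 * k * (∫ u in a..b, h u) + k ^ 2 * L := by
    have : ∀ u, (h u - k * v u) ^ 2 / v u = h u ^ 2 / v u - 2 * k * h u + k ^ 2 * v u := by
      intro u
      have := (hv0 u).ne'
      field_simp
      ring
    simp only [this]
    rw [intervalIntegral.integral_add, intervalIntegral.integral_sub,
      intervalIntegral.integral_const_mul, intervalIntegral.integral_const_mul]
    · exact hdiv.intervalIntegrable a b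
    · exact (hh.const_mul _).intervalIntegrable a b
    · exact (hdiv.sub (hh.const_mul _)).intervalIntegrable a b
    · exact (hv.const_mul _).intervalIntegrable a b
  have hnn : ∀ u, 0 ≤ (h u - k * v u) ^ 2 / v u := fun u =>
    div_nonneg (sq_nonneg _) (hv0 u).le
  have hge : 0 ≤ ∫ u in a..b, (h u - k * v u) ^ 2 / v u :=
    intervalIntegral.integral_nonneg hab.le fun u _ => hnn u
  have hkA : k * A = A ^ 2 / L := by rw [hk]; ring
  have hkL : k ^ 2 * L = A ^ 2 / L := by rw [hk]; field_simp
  have hkh : k * A ≤ k * ∫ u in a..b, h u := by gcongr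
  refine ⟨by nlinarith, fun heq => ⟨k, fun u hu => ?_⟩⟩
  have hzero : ∫ u in a..b, (h u - k * v u) ^ 2 / v u = 0 := by nlinarith
  by_contra hne
  have : 0 < ∫ u in a..b, (h u - k * v u) ^ 2 / v u :=
    intervalIntegral.integral_pos hab hdiv'.continuousOn (fun x _ => hnn x)
      ⟨u, hu, div_pos (by have := sub_ne_zero.2 hne; positivity) (hv0 u)⟩
  linarith

/-- Differentiation under the integral sign on a half-open time interval. -/
theorem hasDerivWithinAt_intervalIntegral_Ico {f f' : ℝ → ℝ → ℝ} {a b T t : ℝ}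
    (ht : t ∈ Set.Ico 0 T) (hab : a ≤ b)
    (hf : ∀ s ∈ Set.Ico 0 T, Continuous fun u => f u s)
    (hf' : ContinuousOn (fun p : ℝ × ℝ => f' p.1 p.2) (Set.univ ×ˢ Set.Ico 0 T))
    (hder : ∀ s ∈ Set.Ico 0 T, ∀ u, HasDerivWithinAt (f u) (f' u s) (Set.Ico 0 T) s) :
    HasDerivWithinAt (fun s => ∫ u in a..b, f u s) (∫ u in a..b, f' u t) (Set.Ico 0 T) t := by
  obtain ⟨r, htr, hrT⟩ := exists_between ht.2
  have hsub : Set.Icc 0 r ⊆ Set.Ico 0 T := fun x hx => ⟨hx.1, hx.2.trans_lt hrT⟩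
  obtain ⟨C, hC⟩ := (isCompact_Icc.prod isCompact_Icc).exists_bound_of_continuousOn
    (hf'.mono (Set.prod_mono (Set.subset_univ (Set.Icc a b)) hsub))
  rw [hasDerivWithinAt_iff_tendsto_slope]
  have hev : ∀ᶠ s in 𝓝[Set.Ico 0 T \ {t}] t, s ∈ Set.Icc 0 r := by
    have h1 : ∀ᶠ s in 𝓝[Set.Ico 0 T \ {t}] t, s < r :=
      nhdsWithin_le_nhds (Iio_mem_nhds htr)
    filter_upwards [h1, self_mem_nhdsWithin] with s hs hs'
    exact ⟨hs'.1.1, hs.le⟩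
  have key : Filter.Tendsto (fun s => ∫ u in a..b, slope (f u) t s) (𝓝[Set.Ico 0 T \ {t}] t)
      (𝓝 (∫ u in a..b, f' u t)) := by
    apply intervalIntegral.tendsto_integral_filter_of_dominated_convergence (fun _ => C)
    · filter_upwards [hev] with s hs
      apply Continuous.aestronglyMeasurable
      simp only [slope, vsub_eq_sub]
      exact ((hf s (hsub hs)).sub (hf t ht)).const_smul (s - t)⁻¹
    · filter_upwards [hev] with s hs
      refine Filter.Eventually.of_forall fun u hu => ?_
      rw [Set.uIoc_of_le hab] at hu
      have hmv := (convex_Icc (0 : ℝ) r).norm_image_sub_le_of_norm_hasDerivWithin_le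
        (f := f u) (f' := f' u) (C := C) (x := t) (y := s)
        (fun x hx => (hder x (hsub hx) u).mono hsub)
        (fun x hx => hC (u, x) ⟨⟨hu.1.le, hu.2⟩, hx⟩) ⟨ht.1, htr.le⟩ hs
      have hC0 : 0 ≤ C := (norm_nonneg _).trans (hC (u, t) ⟨⟨hu.1.le, hu.2⟩, ht.1, htr.le⟩)
      rw [slope_def_field, norm_div]
      exact div_le_of_le_mul₀ (norm_nonneg _) hC0 hmv
    · exact intervalIntegrable_const
    · refine Filter.Eventually.of_forall fun u _ => ?_
      exact hasDerivWithinAt_iff_tendsto_slope.1 (hder t ht u)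
  refine key.congr' ?_
  filter_upwards [hev] with s hs
  simp only [slope, vsub_eq_sub]
  rw [intervalIntegral.integral_smul, intervalIntegral.integral_sub]
  · exact (hf s (hsub hs)).intervalIntegrable a b
  · exact (hf t ht).intervalIntegrable a b

end General

section SphericalCurve

variable {E : Type*} [NormedAddCommGroup E] [InnerProductSpace ℝ E]

/-- The unit tangent of a parametrised curve. -/
def unitTangent (c : ℝ → E) (u : ℝ) : E := ‖deriv c u‖⁻¹ • deriv c u

variable {c : ℝ → E}

theorem norm_unitTangent (hreg : ∀ u, deriv c u ≠ 0) (u : ℝ) : ‖unitTangent c u‖ = 1 := by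
  rw [unitTangent, norm_smul, norm_inv, norm_norm, inv_mul_cancel₀ (norm_ne_zero_iff.2 (hreg u))]

theorem norm_deriv_smul_unitTangent (hreg : ∀ u, deriv c u ≠ 0) (u : ℝ) :
    ‖deriv c u‖ • unitTangent c u = deriv c u := by
  rw [unitTangent, smul_smul, mul_inv_cancel₀ (norm_ne_zero_iff.2 (hreg u)), one_smul]

theorem contDiff_norm_deriv (hc : ContDiff ℝ ∞ c) (hreg : ∀ u, deriv c u ≠ 0) :
    ContDiff ℝ ∞ fun u => ‖deriv c u‖ :=
  (contDiff_infty_iff_deriv.1 hc).2.norm ℝ hreg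

theorem contDiff_inv_norm_deriv (hc : ContDiff ℝ ∞ c) (hreg : ∀ u, deriv c u ≠ 0) :
    ContDiff ℝ ∞ fun u => ‖deriv c u‖⁻¹ :=
  (contDiff_norm_deriv hc hreg).inv fun u => norm_ne_zero_iff.2 (hreg u)

theorem contDiff_unitTangent (hc : ContDiff ℝ ∞ c) (hreg : ∀ u, deriv c u ≠ 0) :
    ContDiff ℝ ∞ (unitTangent c) :=
  (contDiff_inv_norm_deriv hc hreg).smul (contDiff_infty_iff_deriv.1 hc).2

/-- The geodesic curvature vector of a parametrised spherical curve. -/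
def geodesicCurvature (c : ℝ → E) (u : ℝ) : E := ‖deriv c u‖⁻¹ • deriv (unitTangent c) u + c u

theorem contDiff_geodesicCurvature (hc : ContDiff ℝ ∞ c) (hreg : ∀ u, deriv c u ≠ 0) :
    ContDiff ℝ ∞ (geodesicCurvature c) :=
  ((contDiff_inv_norm_deriv hc hreg).smul
    (contDiff_infty_iff_deriv.1 (contDiff_unitTangent hc hreg)).2).add hc

theorem inner_unitTangent_deriv_unitTangent (hc : ContDiff ℝ ∞ c) (hreg : ∀ u, deriv c u ≠ 0)
    (u : ℝ) : inner ℝ (unitTangent c u) (deriv (unitTangent c) u) = 0 :=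
  inner_deriv_eq_zero_of_norm_eq_one_s13 ((contDiff_unitTangent hc hreg).differentiable (by simp))
    (norm_unitTangent hreg) u

theorem inner_deriv_add_inner_deriv_eq_zero {f g : ℝ → E} (hf : Differentiable ℝ f)
    (hg : Differentiable ℝ g) (h : ∀ u, inner ℝ (f u) (g u) = 0) (u : ℝ) :
    inner ℝ (f u) (deriv g u) + inner ℝ (deriv f u) (g u) = 0 := by
  have h1 := (hf u).hasDerivAt.inner ℝ (hg u).hasDerivAt
  rw [show (fun x => inner ℝ (f x) (g x)) = fun _ => (0 : ℝ) from funext h] at h1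
  exact h1.unique (hasDerivAt_const u (0 : ℝ))

theorem inner_unitTangent_self (hc : ContDiff ℝ ∞ c) (h1 : ∀ u, ‖c u‖ = 1) (u : ℝ) :
    inner ℝ (unitTangent c u) (c u) = 0 := by
  rw [unitTangent, inner_smul_left, real_inner_comm,
    inner_deriv_eq_zero_of_norm_eq_one_s13 (hc.differentiable (by simp)) h1, mul_zero]

theorem inner_deriv_unitTangent_self (hc : ContDiff ℝ ∞ c) (hreg : ∀ u, deriv c u ≠ 0)
    (h1 : ∀ u, ‖c u‖ = 1) (u : ℝ) :
    inner ℝ (deriv (unitTangent c) u) (c u) = -‖deriv c u‖ := by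
  have h := inner_deriv_add_inner_deriv_eq_zero
    ((contDiff_unitTangent hc hreg).differentiable (by simp)) (hc.differentiable (by simp))
    (inner_unitTangent_self hc h1) u
  have h2 : inner ℝ (unitTangent c u) (deriv c u) = ‖deriv c u‖ := by
    rw [← norm_deriv_smul_unitTangent hreg u, inner_smul_right, real_inner_self_eq_norm_sq,
      norm_smul, norm_unitTangent hreg, norm_norm]
    ring
  linarith

theorem inner_unitTangent_geodesicCurvature (hc : ContDiff ℝ ∞ c) (hreg : ∀ u, deriv c u ≠ 0)
    (h1 : ∀ u, ‖c u‖ = 1) (u : ℝ) :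
    inner ℝ (unitTangent c u) (geodesicCurvature c u) = 0 := by
  rw [geodesicCurvature, inner_add_right, inner_smul_right,
    inner_unitTangent_deriv_unitTangent hc hreg, inner_unitTangent_self hc h1]
  ring

theorem inner_unitTangent_deriv_geodesicCurvature (hc : ContDiff ℝ ∞ c)
    (hreg : ∀ u, deriv c u ≠ 0) (h1 : ∀ u, ‖c u‖ = 1) (u : ℝ) :
    inner ℝ (unitTangent c u) (deriv (geodesicCurvature c) u) =
      ‖deriv c u‖ - ‖deriv (unitTangent c) u‖ ^ 2 / ‖deriv c u‖ := by
  have h := inner_deriv_add_inner_deriv_eq_zero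
    ((contDiff_unitTangent hc hreg).differentiable (by simp))
    ((contDiff_geodesicCurvature hc hreg).differentiable (by simp))
    (inner_unitTangent_geodesicCurvature hc hreg h1) u
  have h2 : inner ℝ (deriv (unitTangent c) u) (geodesicCurvature c u) =
      ‖deriv c u‖⁻¹ * ‖deriv (unitTangent c) u‖ ^ 2 + -‖deriv c u‖ := by
    rw [geodesicCurvature, inner_add_right, inner_smul_right, real_inner_self_eq_norm_sq,
      inner_deriv_unitTangent_self hc hreg h1]
  rw [div_eq_inv_mul]
  linarith

theorem norm_geodesicCurvature_sq (hc : ContDiff ℝ ∞ c)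
    (hreg : ∀ u, deriv c u ≠ 0) (h1 : ∀ u, ‖c u‖ = 1) (u : ℝ) :
    ‖geodesicCurvature c u‖ ^ 2 = (‖deriv (unitTangent c) u‖ / ‖deriv c u‖) ^ 2 - 1 := by
  have h0 : ‖deriv c u‖ ≠ 0 := norm_ne_zero_iff.2 (hreg u)
  rw [geodesicCurvature, norm_add_sq_real, inner_smul_left, inner_deriv_unitTangent_self hc hreg h1,
    norm_smul, h1, norm_inv, norm_norm]
  simp only [conj_trivial]
  field_simp
  ring

end SphericalCurve

theorem Function.Periodic.deriv_of_periodic {E : Type*} [NormedAddCommGroup E] [NormedSpace ℝ E]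
    {f : ℝ → E} {p : ℝ} (hf : Function.Periodic f p) : Function.Periodic (deriv f) p := by
  intro u
  rw [← deriv_comp_add_const, show (fun x => f (x + p)) = f from funext hf]

theorem Function.Periodic.unitTangent {E : Type*} [NormedAddCommGroup E] [InnerProductSpace ℝ E]
    {c : ℝ → E} {p : ℝ} (hc : Function.Periodic c p) : Function.Periodic (unitTangent c) p := by
  intro u
  simp only [_root_.unitTangent, hc.deriv_of_periodic u]

theorem Function.Periodic.geodesicCurvature {E : Type*} [NormedAddCommGroup E]
    [InnerProductSpace ℝ E] {c : ℝ → E} {p : ℝ} (hc : Function.Periodic c p) :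
    Function.Periodic (geodesicCurvature c) p := by
  intro u
  simp only [_root_.geodesicCurvature, hc.deriv_of_periodic u, hc u,
    hc.unitTangent.deriv_of_periodic u]

section MixedPartials

variable {E : Type*} [NormedAddCommGroup E] [NormedSpace ℝ E]

theorem hasDerivAt_space_of_differentiableOn {D : Set ℝ} {G : ℝ × ℝ → E}
    (hG : DifferentiableOn ℝ G (Set.univ ×ˢ D)) {t : ℝ} (ht : t ∈ D) (u : ℝ) :
    HasDerivAt (fun v => G (v, t)) (fderivWithin ℝ G (Set.univ ×ˢ D) (u, t) (1, 0)) u := by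
  rw [← hasDerivWithinAt_univ]
  exact (hG (u, t) ⟨trivial, ht⟩).hasFDerivWithinAt.comp_hasDerivWithinAt u
    (((hasDerivAt_id u).prodMk (hasDerivAt_const u t)).hasDerivWithinAt)
    (t := Set.univ ×ˢ D) (fun v _ => ⟨trivial, ht⟩)

theorem hasDerivWithinAt_time_of_differentiableOn {D : Set ℝ} {G : ℝ × ℝ → E}
    (hG : DifferentiableOn ℝ G (Set.univ ×ˢ D)) {t : ℝ} (ht : t ∈ D) (u : ℝ) :
    HasDerivWithinAt (fun s => G (u, s)) (fderivWithin ℝ G (Set.univ ×ˢ D) (u, t) (0, 1)) D t :=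
  (hG (u, t) ⟨trivial, ht⟩).hasFDerivWithinAt.comp_hasDerivWithinAt t
    (((hasDerivAt_const t u).prodMk (hasDerivAt_id t)).hasDerivWithinAt)
    (t := Set.univ ×ˢ D) (fun _ hs => ⟨trivial, hs⟩)

/-- The mixed partial derivatives of a smooth map on `ℝ × [0, T)` agree. -/
theorem fderivWithin_fderivWithin_swap {T : ℝ} {G : ℝ × ℝ → E}
    (hG : ContDiffOn ℝ ∞ G (Set.univ ×ˢ Set.Ico 0 T)) {p : ℝ × ℝ}
    (hp : p ∈ (Set.univ : Set ℝ) ×ˢ Set.Ico 0 T) (x y : ℝ × ℝ) :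
    fderivWithin ℝ (fun q => fderivWithin ℝ G (Set.univ ×ˢ Set.Ico 0 T) q x)
        (Set.univ ×ˢ Set.Ico 0 T) p y =
      fderivWithin ℝ (fun q => fderivWithin ℝ G (Set.univ ×ˢ Set.Ico 0 T) q y)
        (Set.univ ×ˢ Set.Ico 0 T) p x := by
  have hT : (0 : ℝ) < T := hp.2.1.trans_lt hp.2.2
  have hS : UniqueDiffOn ℝ ((Set.univ : Set ℝ) ×ˢ Set.Ico (0 : ℝ) T) :=
    uniqueDiffOn_univ.prod (uniqueDiffOn_Ico 0 T)
  have hd : DifferentiableWithinAt ℝ (fderivWithin ℝ G (Set.univ ×ˢ Set.Ico 0 T))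
      (Set.univ ×ˢ Set.Ico 0 T) p :=
    ((hG.fderivWithin hS (m := ∞) (by simp)).differentiableOn (by simp)) p hp
  have hev : ∀ z : ℝ × ℝ, fderivWithin ℝ (fun q => fderivWithin ℝ G (Set.univ ×ˢ Set.Ico 0 T) q z)
      (Set.univ ×ˢ Set.Ico 0 T) p = (fderivWithin ℝ (fderivWithin ℝ G (Set.univ ×ˢ Set.Ico 0 T))
        (Set.univ ×ˢ Set.Ico 0 T) p).flip z := by
    intro z
    exact (((ContinuousLinearMap.apply ℝ E z).hasFDerivAt.comp_hasFDerivWithinAt p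
      hd.hasFDerivWithinAt).fderivWithin (hS p hp))
  have hcl : p ∈ closure (interior ((Set.univ : Set ℝ) ×ˢ Set.Ico (0 : ℝ) T)) := by
    rw [interior_prod_eq, closure_prod_eq, interior_univ, closure_univ, interior_Ico,
      closure_Ioo hT.ne]
    exact ⟨trivial, hp.2.1, hp.2.2.le⟩
  have hsymm := (hG p hp).isSymmSndFDerivWithinAt
    (by simpa using WithTop.coe_le_coe.2 (le_top : (2 : ℕ∞) ≤ ⊤)) hS hcl hp
  rw [hev, hev]
  exact hsymm y x

end MixedPartials

/-- Under curve shortening flow of simple closed curves on `S²`, the total length `L` is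
differentiable and satisfies `L'(t) ≤ L(t) − 4π²/L(t)`, with strict inequality unless the
geodesic curvature of `Γ_t` is constant. -/
theorem length_evolution_inequality (T : ℝ) (hT : 0 < T)
    (F : SphereCSF (Set.Ico 0 T)) (t : ℝ) (ht : t ∈ Set.Ico (0 : ℝ) T) :
    ∃ L' : ℝ, HasDerivWithinAt F.length L' (Set.Ico 0 T) t ∧
      L' ≤ F.length t - 4 * π ^ 2 / F.length t ∧
      (L' = F.length t - 4 * π ^ 2 / F.length t → ∃ c : ℝ, ∀ u : ℝ, F.curvSq u t = c) := by
  have hS : UniqueDiffOn ℝ ((Set.univ : Set ℝ) ×ˢ Set.Ico (0 : ℝ) T) :=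
    uniqueDiffOn_univ.prod (uniqueDiffOn_Ico 0 T)
  set G : ℝ × ℝ → EuclideanSpace ℝ (Fin 3) := fun p => F.γ p.1 p.2 with hGdef
  set S := (Set.univ : Set ℝ) ×ˢ Set.Ico (0 : ℝ) T with hSdef
  have hG : ContDiffOn ℝ ∞ G S := F.smooth
  have hG' : ContDiffOn ℝ ∞ (fderivWithin ℝ G S) S := hG.fderivWithin hS (by simp)
  have hX : ContDiffOn ℝ ∞ (fun q => fderivWithin ℝ G S q (1, 0)) S :=
    hG'.clm_apply contDiffOn_const
  have hY : ContDiffOn ℝ ∞ (fun q => fderivWithin ℝ G S q (0, 1)) S :=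
    hG'.clm_apply contDiffOn_const
  have hXZ : ContinuousOn (fun p => fderivWithin ℝ (fun q => fderivWithin ℝ G S q (1, 0)) S p
      (0, 1)) S :=
    ((hX.fderivWithin hS (m := ∞) (by simp)).clm_apply contDiffOn_const).continuousOn
  have hcurve : ∀ s ∈ Set.Ico 0 T, ContDiff ℝ ∞ fun u => F.γ u s := fun s hs =>
    contDiffOn_univ.1 (hG.comp (f := fun u : ℝ => (u, s)) (by fun_prop) fun u _ => ⟨trivial, hs⟩)
  have hXd : ∀ s ∈ Set.Ico 0 T, ∀ u,
      deriv (fun v => F.γ v s) u = fderivWithin ℝ G S (u, s) (1, 0) := fun s hs u =>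
    (hasDerivAt_space_of_differentiableOn (hG.differentiableOn (by simp)) hs u).deriv
  have hYd : ∀ s ∈ Set.Ico 0 T, ∀ u,
      fderivWithin ℝ G S (u, s) (0, 1) = geodesicCurvature (fun v => F.γ v s) u := fun s hs u =>
    (uniqueDiffOn_Ico 0 T s hs).eq_deriv _
      (hasDerivWithinAt_time_of_differentiableOn (hG.differentiableOn (by simp)) hs u)
      (F.flow s hs u)
  have hmixed : ∀ s ∈ Set.Ico 0 T, ∀ u,
      fderivWithin ℝ (fun q => fderivWithin ℝ G S q (1, 0)) S (u, s) (0, 1) =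
        deriv (geodesicCurvature fun v => F.γ v s) u := by
    intro s hs u
    rw [fderivWithin_fderivWithin_swap hG ⟨trivial, hs⟩,
      ← (hasDerivAt_space_of_differentiableOn (hY.differentiableOn (by simp)) hs u).deriv]
    congr 1
    exact funext fun v => hYd s hs v
  have hspeed : ∀ s ∈ Set.Ico 0 T, ∀ u, HasDerivWithinAt (F.speed u)
      (inner ℝ (fderivWithin ℝ G S (u, s) (1, 0))
        (fderivWithin ℝ (fun q => fderivWithin ℝ G S q (1, 0)) S (u, s) (0, 1)) /
          ‖fderivWithin ℝ G S (u, s) (1, 0)‖) (Set.Ico 0 T) s := by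
    intro s hs u
    have hne : fderivWithin ℝ G S (u, s) (1, 0) ≠ 0 := hXd s hs u ▸ F.regular s hs u
    have h := hasDerivWithinAt_time_of_differentiableOn (hX.differentiableOn (by simp)) hs u
    have h2 := (h.norm_sq).sqrt (by simpa using hne)
    refine (h2.congr_deriv ?_).congr (fun r hr => ?_) ?_
    · rw [sqrt_sq (norm_nonneg _)]
      exact mul_div_mul_left _ _ two_ne_zero
    · rw [sqrt_sq (norm_nonneg _), SphereCSF.speed, hXd r hr u]
    · rw [sqrt_sq (norm_nonneg _), SphereCSF.speed, hXd s hs u]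
  have hLder := hasDerivWithinAt_intervalIntegral_Ico (f := F.speed)
    (f' := fun u s => inner ℝ (fderivWithin ℝ G S (u, s) (1, 0))
        (fderivWithin ℝ (fun q => fderivWithin ℝ G S q (1, 0)) S (u, s) (0, 1)) /
          ‖fderivWithin ℝ G S (u, s) (1, 0)‖) ht two_pi_pos.le
    (fun s hs => (contDiff_norm_deriv (hcurve s hs) (F.regular s hs)).continuous)
    ((hX.continuousOn.inner hXZ).div hX.continuousOn.norm fun p hp =>
      norm_ne_zero_iff.2 (hXd p.2 hp.2 p.1 ▸ F.regular p.2 hp.2 p.1)) hspeed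
  set c : ℝ → EuclideanSpace ℝ (Fin 3) := fun v => F.γ v t with hcdef
  have hc : ContDiff ℝ ∞ c := hcurve t ht
  have hreg : ∀ u, deriv c u ≠ 0 := F.regular t ht
  have h1 : ∀ u, ‖c u‖ = 1 := F.spherical t ht
  have hper : Function.Periodic c (2 * π) := F.periodic t ht
  have hv : Continuous fun u => ‖deriv c u‖ := (contDiff_norm_deriv hc hreg).continuous
  have hv0 : ∀ u, 0 < ‖deriv c u‖ := fun u => norm_pos_iff.2 (hreg u)
  have hτ := contDiff_unitTangent hc hreg
  have hh : Continuous fun u => ‖deriv (unitTangent c) u‖ :=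
    (hτ.continuous_deriv (by simp)).norm
  have hint : (∫ u in (0 : ℝ)..(2 * π), inner ℝ (fderivWithin ℝ G S (u, t) (1, 0))
        (fderivWithin ℝ (fun q => fderivWithin ℝ G S q (1, 0)) S (u, t) (0, 1)) /
          ‖fderivWithin ℝ G S (u, t) (1, 0)‖) =
      F.length t - ∫ u in (0 : ℝ)..(2 * π), ‖deriv (unitTangent c) u‖ ^ 2 / ‖deriv c u‖ := by
    rw [SphereCSF.length, ← intervalIntegral.integral_sub]
    · refine intervalIntegral.integral_congr fun u _ => ?_
      change _ = ‖deriv c u‖ - _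
      rw [← inner_unitTangent_deriv_geodesicCurvature hc hreg h1 u]
      simp only [hmixed t ht, ← hXd t ht]
      rw [unitTangent, inner_smul_left, div_eq_inv_mul]
      rfl
    · exact hv.intervalIntegrable _ _
    · exact ((hh.pow 2).div hv fun u => (hv0 u).ne').intervalIntegrable _ _
  have hmean : ∫ u in (0 : ℝ)..(2 * π), ‖deriv c u‖ • unitTangent c u = 0 := by
    simp only [norm_deriv_smul_unitTangent hreg]
    rw [intervalIntegral.integral_deriv_eq_sub (fun u _ => hc.differentiable (by simp) u)
      ((hc.continuous_deriv (by simp)).intervalIntegrable _ _)]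
    have := hper 0
    rw [zero_add] at this
    rw [this, sub_self]
  have hfenchel := two_pi_le_integral_norm_deriv two_pi_pos (hτ.of_le (by simp))
    (norm_unitTangent hreg) hv hv0 (by simpa using (hper.unitTangent 0).symm) hmean
  obtain ⟨hle, heq⟩ :=
    sq_div_integral_le_integral_sq_div two_pi_pos two_pi_pos.le hv hv0 hh hfenchel
  have hA : (2 * π) ^ 2 / (∫ u in (0 : ℝ)..(2 * π), ‖deriv c u‖) = 4 * π ^ 2 / F.length t := by
    rw [mul_pow]
    norm_num
    rfl
  rw [hA] at hle heq
  refine ⟨_, hLder, ?_, ?_⟩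
  · rw [hint]
    linarith
  · rw [hint]
    intro h
    obtain ⟨k, hk⟩ := heq (by linarith)
    refine ⟨k ^ 2 - 1, fun u => ?_⟩
    obtain ⟨w, hw, hwu⟩ := hper.geodesicCurvature.exists_mem_Ico₀ two_pi_pos u
    change ‖geodesicCurvature c u‖ ^ 2 = _
    rw [hwu, norm_geodesicCurvature_sq hc hreg h1, hk w (Set.Ico_subset_Icc_self hw),
      mul_div_cancel_right₀ _ (hv0 w).ne']

end
end
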